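/- Let G be a finite group, N a normal subgroup of G, F an algebraically closed field whose characteristic does not divide |A(G) ∩ N|, and k ≥ 1. The following are equivalent: (1) S(G) ∩ N is k-generated as a normal subgroup of G; (2) there exists an F[G]-module V that is a direct sum of k simple F[G]-modules and whose restriction to N is faithful (the only element of N acting as the identity on V is 1); (3) there exists a finite-dimensional F[G]-module of length k (i.e., having a composition series with k composition factors) whose restriction to N is faithful. -/

import Mathlib

variable {G : Type*} [Group G]

/-- A minimal normal subgroup of a group `G`: a nontrivial normal subgroup that is
minimal among the nontrivial normal subgroups of `G`. -/
def IsMinimalNormal (M : Subgroup G) : Prop :=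
  M.Normal ∧ M ≠ ⊥ ∧ ∀ K : Subgroup G, K.Normal → K ≠ ⊥ → K ≤ M → K = M

/-- `A(G)`: the subgroup generated by all abelian minimal normal subgroups of `G`. -/
def aSocle (G : Type*) [Group G] : Subgroup G :=
  sSup {M : Subgroup G | IsMinimalNormal M ∧ ∀ x ∈ M, ∀ y ∈ M, x * y = y * x}

/-- The socle `S(G)`: the subgroup generated by all minimal normal subgroups of `G`. -/
def socle (G : Type*) [Group G] : Subgroup G :=
  sSup {M : Subgroup G | IsMinimalNormal M}

/-- `H` is generated by `k` (not necessarily distinct) elements as a normal subgroup of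
`G`: there are `k` elements of `H` whose normal closure in `G` is `H`. -/
def NormallyKGenerated (H : Subgroup G) (k : ℕ) : Prop :=
  ∃ f : Fin k → G, (∀ i, f i ∈ H) ∧ Subgroup.normalClosure (Set.range f) = H



section Duality

variable {R : Type} [Ring R]

/-- `k`-generation of a module. -/
def ModGen (R : Type) [Ring R] (k : ℕ) (A : Type) [AddCommGroup A] [Module R A] : Prop :=
  ∃ a : Fin k → A, Submodule.span R (Set.range a) = ⊤

/-- There are `k` characters with no common nonzero submodule in the kernel. -/
def ModSep (R : Type) [Ring R] (Z : Type) [AddCommGroup Z] (k : ℕ)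
    (A : Type) [AddCommGroup A] [Module R A] : Prop :=
  ∃ χ : Fin k → (A →+ Z), ∀ B : Submodule R A, (∀ i, ∀ b ∈ B, χ i b = 0) → B = ⊥

theorem ModGen.congr {k : ℕ} {A A' : Type} [AddCommGroup A] [Module R A] [AddCommGroup A']
    [Module R A'] (e : A ≃ₗ[R] A') (h : ModGen R k A) : ModGen R k A' := by
  obtain ⟨a, ha⟩ := h
  refine ⟨fun i => e (a i), ?_⟩
  have : Set.range (fun i => e (a i)) = e '' Set.range a := by
    rw [← Set.range_comp]; rfl
  rw [this]
  have h2 := Submodule.map_span (e : A →ₗ[R] A') (Set.range a)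
  rw [ha, Submodule.map_top, LinearEquiv.range] at h2
  exact h2.symm

theorem ModSep.congr {Z : Type} [AddCommGroup Z] {k : ℕ} {A A' : Type} [AddCommGroup A]
    [Module R A] [AddCommGroup A']
    [Module R A'] (e : A ≃ₗ[R] A') (h : ModSep R Z k A) : ModSep R Z k A' := by
  obtain ⟨χ, hχ⟩ := h
  refine ⟨fun i => (χ i).comp (e.symm : A' →+ A), fun B hB => ?_⟩
  have := hχ (B.comap (e : A →ₗ[R] A')) (fun i b hb => by simpa using hB i (e b) hb)
  rw [eq_bot_iff] at this ⊢
  intro b hb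
  have h1 : e.symm b ∈ B.comap (e : A →ₗ[R] A') := by simpa using hb
  simpa using this h1

theorem modGen_prod {k : ℕ} {A M : Type} [AddCommGroup A] [Module R A] [Finite A]
    [AddCommGroup M] [Module R M] [Finite M] [IsSimpleModule R M] :
    ModGen R k (A × M) ↔ ModGen R k A ∧ Nat.card (A →ₗ[R] M) < Nat.card M ^ k := by
  have hfin : Finite (A →ₗ[R] M) := DFunLike.finite _
  have hnt : Nontrivial M := IsSimpleModule.nontrivial R M
  have hcard : Nat.card (Fin k → M) = Nat.card M ^ k := by simp [Nat.card_fun]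
  have hinj : ∀ a : Fin k → A, Submodule.span R (Set.range a) = ⊤ →
      Function.Injective (fun (f : A →ₗ[R] M) (i : Fin k) => f (a i)) := by
    intro a ha f g hfg
    apply LinearMap.ext_on_range (v := a) ha
    intro i
    exact congrFun hfg i
  constructor
  · rintro ⟨c, hc⟩
    have ha : Submodule.span R (Set.range fun i => (c i).1) = ⊤ := by
      have h2 := Submodule.map_span (LinearMap.fst R A M) (Set.range c)
      rw [hc, Submodule.map_top, LinearMap.range_eq_top.2 LinearMap.fst_surjective, ← Set.range_comp] at h2
      exact h2.symm
    refine ⟨⟨_, ha⟩, ?_⟩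
    by_contra hlt
    push Not at hlt
    have hb : Function.Bijective (fun (f : A →ₗ[R] M) (i : Fin k) => f (c i).1) :=
      (Nat.bijective_iff_injective_and_card _).2
        ⟨hinj _ ha, le_antisymm (Nat.card_le_card_of_injective _ (hinj _ ha)) (hcard ▸ hlt)⟩
    obtain ⟨f, hf⟩ := hb.2 (fun i => (c i).2)
    have hg : (⊤ : Submodule R (A × M)) ≤ f.graph := by
      rw [← hc, Submodule.span_le]
      rintro _ ⟨i, rfl⟩
      simp only [SetLike.mem_coe, LinearMap.mem_graph_iff]
      exact (congrFun hf i).symm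
    obtain ⟨m, hm⟩ := exists_ne (0 : M)
    have := hg (show ((0, m) : A × M) ∈ ⊤ from trivial)
    rw [LinearMap.mem_graph_iff] at this
    simp at this
    exact hm this
  · rintro ⟨⟨a, ha⟩, hlt⟩
    have : ¬ Function.Surjective (fun (f : A →ₗ[R] M) (i : Fin k) => f (a i)) := by
      intro hs
      have := Nat.card_le_card_of_surjective _ hs
      omega
    rw [Function.Surjective] at this
    push Not at this
    obtain ⟨m, hm⟩ := this
    refine ⟨fun i => (a i, m i), ?_⟩
    set B := Submodule.span R (Set.range fun i => (a i, m i)) with hB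
    have hfst : B.map (LinearMap.fst R A M) = ⊤ := by
      rw [hB, Submodule.map_span, ← Set.range_comp]
      exact ha
    rcases eq_bot_or_eq_top (B.comap (LinearMap.inr R A M)) with h | h
    · exfalso
      have hbij : Function.Bijective ((LinearMap.fst R A M).domRestrict B) := by
        constructor
        · rw [← LinearMap.ker_eq_bot, eq_bot_iff]
          rintro ⟨⟨x, y⟩, hx⟩ h0
          have h0 : x = 0 := by simpa using h0
          subst h0
          have : y ∈ B.comap (LinearMap.inr R A M) := by simpa using hx
          rw [h] at this
          have : y = 0 := by simpa using this
          subst this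
          simp
        · intro x
          have : x ∈ B.map (LinearMap.fst R A M) := by rw [hfst]; trivial
          obtain ⟨y, hy, rfl⟩ := this
          exact ⟨⟨y, hy⟩, rfl⟩
      let e := LinearEquiv.ofBijective _ hbij
      let f : A →ₗ[R] M := (LinearMap.snd R A M) ∘ₗ B.subtype ∘ₗ e.symm.toLinearMap
      apply hm f
      funext i
      have hi : (a i, m i) ∈ B := Submodule.subset_span ⟨i, rfl⟩
      have : e.symm (a i) = ⟨(a i, m i), hi⟩ := by
        rw [LinearEquiv.symm_apply_eq]
        rfl
      simp [f, this]
    · rw [eq_top_iff]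
      rintro ⟨x, y⟩ -
      have : x ∈ B.map (LinearMap.fst R A M) := by rw [hfst]; trivial
      obtain ⟨⟨x', y'⟩, hy, hx⟩ := this
      have hx : x' = x := hx
      subst hx
      have h2 : y - y' ∈ B.comap (LinearMap.inr R A M) := by rw [h]; trivial
      have h3 := B.add_mem hy h2
      simpa using h3

theorem modSep_prod {Z : Type} [AddCommGroup Z] {k : ℕ} {A M : Type} [AddCommGroup A]
    [Module R A] [Finite A]
    [AddCommGroup M] [Module R M] [Finite M] [IsSimpleModule R M]
    (hZ : Nat.card (M →+ Z) = Nat.card M) :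
    ModSep R Z k (A × M) ↔ ModSep R Z k A ∧ Nat.card (M →ₗ[R] A) < Nat.card M ^ k := by
  have hfin : Finite (M →ₗ[R] A) := DFunLike.finite _
  have hnt : Nontrivial M := IsSimpleModule.nontrivial R M
  have hfin2 : Finite (M →+ Z) := Nat.finite_of_card_ne_zero (by rw [hZ]; exact Nat.card_pos.ne')
  have hcard : Nat.card (Fin k → (M →+ Z)) = Nat.card M ^ k := by simp [Nat.card_fun, hZ]
  have hinj : ∀ χ : Fin k → (A →+ Z),
      (∀ B : Submodule R A, (∀ i, ∀ b ∈ B, χ i b = 0) → B = ⊥) →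
      Function.Injective (fun (f : M →ₗ[R] A) (i : Fin k) => (χ i).comp (f : M →+ A)) := by
    intro χ hχ f g hfg
    have := hχ (LinearMap.range (f - g)) (by
      rintro i _ ⟨m, rfl⟩
      have h1 := DFunLike.congr_fun (congrFun hfg i) m
      have h1 : χ i (f m) = χ i (g m) := h1
      simp [h1])
    rw [LinearMap.range_eq_bot] at this
    exact sub_eq_zero.1 this
  constructor
  · rintro ⟨ξ, hξ⟩
    have ha : ∀ B : Submodule R A, (∀ i, ∀ b ∈ B,
        ((ξ i).comp (AddMonoidHom.inl A M)) b = 0) → B = ⊥ := by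
      intro B hB
      have := hξ (B.map (LinearMap.inl R A M)) (by
        rintro i _ ⟨b, hb, rfl⟩
        exact hB i b hb)
      rw [eq_bot_iff]
      intro b hb
      have h2 : LinearMap.inl R A M b ∈ B.map (LinearMap.inl R A M) := ⟨b, hb, rfl⟩
      rw [this] at h2
      simpa using h2
    refine ⟨⟨_, ha⟩, ?_⟩
    by_contra hlt
    push Not at hlt
    have hb := (Nat.bijective_iff_injective_and_card _).2
        ⟨hinj _ ha, le_antisymm (Nat.card_le_card_of_injective _ (hinj _ ha)) (hcard ▸ hlt)⟩
    obtain ⟨f, hf⟩ := hb.2 (fun i => - (ξ i).comp (AddMonoidHom.inr A M))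
    have hg := hξ (LinearMap.range (f.prod LinearMap.id)) (by
      rintro i _ ⟨m, rfl⟩
      have h1 := DFunLike.congr_fun (congrFun hf i) m
      have h1 : ξ i (f m, 0) = - ξ i (0, m) := h1
      have : (f.prod LinearMap.id) m = (f m, 0) + (0, m) := by simp
      rw [this, map_add, h1]
      simp)
    obtain ⟨m, hm⟩ := exists_ne (0 : M)
    rw [LinearMap.range_eq_bot] at hg
    have := LinearMap.congr_fun hg m
    simp at this
    exact hm this.2
  · rintro ⟨⟨χ, hχ⟩, hlt⟩
    have : ¬ Function.Surjective
        (fun (f : M →ₗ[R] A) (i : Fin k) => (χ i).comp (f : M →+ A)) := by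
      intro hs
      have := Nat.card_le_card_of_surjective _ hs
      omega
    rw [Function.Surjective] at this
    push Not at this
    obtain ⟨μ, hμ⟩ := this
    refine ⟨fun i => (χ i).comp (AddMonoidHom.fst A M) - (μ i).comp (AddMonoidHom.snd A M),
      fun B hB => ?_⟩
    have hB' : ∀ i, ∀ x y, (x, y) ∈ B → χ i x = μ i y := by
      intro i x y h
      have := hB i _ h
      simpa [sub_eq_zero] using this
    have hinl : B.comap (LinearMap.inl R A M) = ⊥ := by
      apply hχ
      intro i b hb
      have := hB' i b 0 hb
      simpa using this
    have hinl' : ∀ x, (x, (0 : M)) ∈ B → x = 0 := by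
      intro x hx
      have : x ∈ B.comap (LinearMap.inl R A M) := hx
      rw [hinl] at this
      simpa using this
    rcases eq_bot_or_eq_top (B.map (LinearMap.snd R A M)) with h | h
    · rw [eq_bot_iff]
      rintro ⟨x, y⟩ hxy
      have : y ∈ B.map (LinearMap.snd R A M) := ⟨_, hxy, rfl⟩
      rw [h] at this
      have : y = 0 := by simpa using this
      subst this
      simp [hinl' x hxy]
    · exfalso
      have hbij : Function.Bijective ((LinearMap.snd R A M).domRestrict B) := by
        constructor
        · rw [← LinearMap.ker_eq_bot, eq_bot_iff]
          rintro ⟨⟨x, y⟩, hx⟩ h0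
          have h0 : y = 0 := by simpa using h0
          subst h0
          have := hinl' x hx
          subst this
          simp
        · intro x
          have : x ∈ B.map (LinearMap.snd R A M) := by rw [h]; trivial
          obtain ⟨y, hy, rfl⟩ := this
          exact ⟨⟨y, hy⟩, rfl⟩
      let e := LinearEquiv.ofBijective _ hbij
      let f : M →ₗ[R] A := (LinearMap.fst R A M) ∘ₗ B.subtype ∘ₗ e.symm.toLinearMap
      apply hμ f
      funext i
      ext m
      have h3 : (e.symm m : A × M).2 = m := e.apply_symm_apply m
      have h4 := hB' i (e.symm m : A × M).1 (e.symm m : A × M).2 (e.symm m).2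
      rw [h3] at h4
      exact h4

theorem card_hom_comm_simple {M M' : Type} [AddCommGroup M] [Module R M] [IsSimpleModule R M]
    [AddCommGroup M'] [Module R M'] [IsSimpleModule R M'] :
    Nat.card (M →ₗ[R] M') = Nat.card (M' →ₗ[R] M) := by
  by_cases h : Nonempty (M ≃ₗ[R] M')
  · obtain ⟨e⟩ := h
    refine Nat.card_congr
      { toFun := fun f => e.symm.toLinearMap ∘ₗ f ∘ₗ e.symm.toLinearMap
        invFun := fun f => e.toLinearMap ∘ₗ f ∘ₗ e.toLinearMap
        left_inv := fun f => by ext; simp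
        right_inv := fun f => by ext; simp }
  · have h1 : ∀ f : M →ₗ[R] M', f = 0 := fun f =>
      (LinearMap.bijective_or_eq_zero f).resolve_left
        fun hb => h ⟨LinearEquiv.ofBijective f hb⟩
    have h2 : ∀ f : M' →ₗ[R] M, f = 0 := fun f =>
      (LinearMap.bijective_or_eq_zero f).resolve_left
        fun hb => h ⟨(LinearEquiv.ofBijective f hb).symm⟩
    have : Unique (M →ₗ[R] M') := ⟨⟨0⟩, h1⟩
    have : Unique (M' →ₗ[R] M) := ⟨⟨0⟩, h2⟩
    simp

theorem exists_prod_simple (A : Type) [AddCommGroup A] [Module R A] [Finite A]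
    [IsSemisimpleModule R A] [Nontrivial A] :
    ∃ (M B : Submodule R A), IsSimpleModule R M ∧ Nat.card B < Nat.card A ∧
      Nonempty (A ≃ₗ[R] (B × M)) := by
  obtain ⟨M, hM⟩ := IsSemisimpleModule.exists_simple_submodule R A
  obtain ⟨B, hB⟩ := exists_isCompl M
  have e := Submodule.prodEquivOfIsCompl B M hB.symm
  refine ⟨M, B, hM, ?_, ⟨e.symm⟩⟩
  have h1 := Nat.card_congr e.toEquiv
  rw [Nat.card_prod] at h1
  have : Nontrivial M := IsSimpleModule.nontrivial R M
  have h2 : 1 < Nat.card M := Finite.one_lt_card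
  have h3 : 0 < Nat.card B := Nat.card_pos
  nlinarith

theorem card_hom_comm {M : Type} [AddCommGroup M] [Module R M] [IsSimpleModule R M] :
    ∀ (n : ℕ) (A : Type) [AddCommGroup A] [Module R A] [Finite A] [IsSemisimpleModule R A],
    Nat.card A = n → Nat.card (M →ₗ[R] A) = Nat.card (A →ₗ[R] M) := by
  intro n
  induction n using Nat.strong_induction_on with
  | _ n ih =>
    intro A _ _ _ _ hn
    rcases subsingleton_or_nontrivial A with h | h
    · have : Unique (M →ₗ[R] A) := ⟨⟨0⟩, fun f => by ext; exact Subsingleton.elim _ _⟩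
      have : Unique (A →ₗ[R] M) := ⟨⟨0⟩, fun f => by
        ext x; rw [Subsingleton.elim x 0]; simp⟩
      simp
    · obtain ⟨S, B, hS, hlt, ⟨e⟩⟩ := exists_prod_simple (R := R) A
      have h1 := ih _ (hn ▸ hlt) B rfl
      have h2 : Nat.card (M →ₗ[R] S) = Nat.card (S →ₗ[R] M) := card_hom_comm_simple
      have e1 : (M →ₗ[R] A) ≃ (M →ₗ[R] B) × (M →ₗ[R] S) :=
        { toFun := fun f => (LinearMap.fst R B S ∘ₗ e.toLinearMap ∘ₗ f,
            LinearMap.snd R B S ∘ₗ e.toLinearMap ∘ₗ f)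
          invFun := fun p => e.symm.toLinearMap ∘ₗ (p.1.prod p.2)
          left_inv := fun f => by ext x; simp
          right_inv := fun f => by ext x <;> simp }
      have e2 : (A →ₗ[R] M) ≃ (B →ₗ[R] M) × (S →ₗ[R] M) :=
        { toFun := fun f => (f ∘ₗ e.symm.toLinearMap ∘ₗ LinearMap.inl R B S,
            f ∘ₗ e.symm.toLinearMap ∘ₗ LinearMap.inr R B S)
          invFun := fun p => (p.1.coprod p.2) ∘ₗ e.toLinearMap
          left_inv := fun f => by
            ext x
            simp [← map_add]
          right_inv := fun f => by ext x <;> simp }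
      rw [Nat.card_congr e1, Nat.card_congr e2, Nat.card_prod, Nat.card_prod, h1, h2]

theorem modGen_iff_modSep (Z : Type) [AddCommGroup Z] (k : ℕ) :
    ∀ (n : ℕ) (A : Type) [AddCommGroup A] [Module R A] [Finite A] [IsSemisimpleModule R A],
    Nat.card A = n →
    (∀ (M : Type) [AddCommGroup M] [Finite M], Nat.card M ∣ Nat.card A →
      Nat.card (M →+ Z) = Nat.card M) → (ModGen R k A ↔ ModSep R Z k A) := by
  intro n
  induction n using Nat.strong_induction_on with
  | _ n ih =>
    intro A _ _ _ _ hn hZ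
    rcases subsingleton_or_nontrivial A with h | h
    · refine ⟨fun _ => ⟨0, fun B _ => Subsingleton.elim _ _⟩, fun _ => ⟨0, Subsingleton.elim _ _⟩⟩
    · obtain ⟨S, B, hS, hlt, ⟨e⟩⟩ := exists_prod_simple (R := R) A
      have hc : Nat.card A = Nat.card B * Nat.card S := by
        rw [Nat.card_congr e.toEquiv, Nat.card_prod]
      have h1 := ih _ (hn ▸ hlt) B rfl (fun M _ _ hM => hZ M (hM.trans (hc ▸ dvd_mul_right _ _)))
      have h2 : Nat.card (S →ₗ[R] B) = Nat.card (B →ₗ[R] S) := card_hom_comm _ B rfl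
      have h3 : ModGen R k A ↔ ModGen R k (B × S) := ⟨fun h => h.congr e, fun h => h.congr e.symm⟩
      have h4 : ModSep R Z k A ↔ ModSep R Z k (B × S) :=
        ⟨fun h => h.congr e, fun h => h.congr e.symm⟩
      rw [h3, h4, modGen_prod, modSep_prod (hZ S (hc ▸ dvd_mul_left _ _)), h1, h2]

end Duality

section ConjModule

open scoped IsMulCommutative

/-- The conjugation action on an abelian normal subgroup as an integral representation. -/
noncomputable def conjRep {G : Type} [Group G] (P : Subgroup G) [P.Normal] [IsMulCommutative P] :
    Representation ℤ G (Additive P) where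
  toFun g := (MonoidHom.toAdditive (MulAut.conjNormal g : P ≃* P).toMonoidHom).toIntLinearMap
  map_one' := by ext x; simp
  map_mul' g h := by ext x; simp

theorem conjRep_apply {G : Type} [Group G] (P : Subgroup G) [P.Normal] [IsMulCommutative P]
    (g : G) (x : Additive P) :
    ((conjRep P g x).toMul : G) = g * (x.toMul : G) * g⁻¹ := by
  simp [conjRep]

/-- The module. -/
abbrev CMod {G : Type} [Group G] (P : Subgroup G) [P.Normal] [IsMulCommutative P] : Type :=
  (conjRep P).asModule

variable {G : Type} [Group G] (P : Subgroup G) [P.Normal] [IsMulCommutative P]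

/-- Element of the module to element of the group. -/
noncomputable def cval (x : CMod P) : G := (((conjRep P).asModuleEquiv x).toMul : G)

/-- Element of the subgroup to element of the module. -/
noncomputable def cmk (x : P) : CMod P := (conjRep P).asModuleEquiv.symm (Additive.ofMul x)

theorem cval_cmk (x : P) : cval P (cmk P x) = x := by simp [cval, cmk]

theorem cval_mem (x : CMod P) : cval P x ∈ P := SetLike.coe_mem _

theorem cval_inj {x y : CMod P} (h : cval P x = cval P y) : x = y := by
  apply (conjRep P).asModuleEquiv.injective
  apply Additive.toMul.injective
  exact Subtype.ext h

theorem cmk_cval (x : CMod P) : cmk P ⟨cval P x, cval_mem P x⟩ = x :=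
  cval_inj P (cval_cmk P _)

theorem cval_add (x y : CMod P) : cval P (x + y) = cval P x * cval P y := by simp [cval]

theorem cval_zero : cval P 0 = 1 := by simp [cval]

theorem cval_neg (x : CMod P) : cval P (-x) = (cval P x)⁻¹ := by
  rw [eq_inv_iff_mul_eq_one, ← cval_add]; simp [cval_zero]

theorem cval_smul (g : G) (x : CMod P) :
    cval P (MonoidAlgebra.of ℤ G g • x) = g * cval P x * g⁻¹ := by
  simp only [cval, Representation.asModuleEquiv_map_smul, Representation.asAlgebraHom_of,
    conjRep_apply]

theorem smul_mem_of_conj {M : Type} [AddCommGroup M] [Module (MonoidAlgebra ℤ G) M]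
    (S : AddSubgroup M)
    (h : ∀ g : G, ∀ x ∈ S, MonoidAlgebra.of ℤ G g • x ∈ S) (r : MonoidAlgebra ℤ G)
    (x : M) (hx : x ∈ S) : r • x ∈ S := by
  induction r using MonoidAlgebra.induction_on with
  | of g => exact h g x hx
  | add a b ha hb => rw [add_smul]; exact S.add_mem ha hb
  | smul n a ha =>
    rw [zsmul_eq_mul, mul_smul, Int.cast_smul_eq_zsmul]
    exact S.zsmul_mem ha n

/-- Submodule attached to a normal subgroup. -/
noncomputable def toSub (K : Subgroup G) (hK : K.Normal) :
    Submodule (MonoidAlgebra ℤ G) (CMod P) where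
  carrier := {x | cval P x ∈ K}
  add_mem' {x y} hx hy := by
    simp only [Set.mem_ofPred_eq] at *
    rw [cval_add]; exact K.mul_mem hx hy
  zero_mem' := by simp [cval_zero, K.one_mem]
  smul_mem' r x hx := smul_mem_of_conj
    { carrier := {x | cval P x ∈ K}
      add_mem' := fun {x y} hx hy => by
        simp only [Set.mem_ofPred_eq] at *
        rw [cval_add]; exact K.mul_mem hx hy
      zero_mem' := by simp [cval_zero, K.one_mem]
      neg_mem' := fun {x} hx => by
        simp only [Set.mem_ofPred_eq] at *
        rw [cval_neg]; exact K.inv_mem hx }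
    (fun g x hx => by
      show cval P _ ∈ K
      rw [cval_smul]; exact hK.conj_mem _ hx g) r x hx

theorem mem_toSub {K : Subgroup G} {hK : K.Normal} {x : CMod P} :
    x ∈ toSub P K hK ↔ cval P x ∈ K := Iff.rfl

/-- Normal subgroup attached to a submodule. -/
noncomputable def ofSub (B : Submodule (MonoidAlgebra ℤ G) (CMod P)) : Subgroup G where
  carrier := cval P '' B
  mul_mem' := by
    rintro _ _ ⟨x, hx, rfl⟩ ⟨y, hy, rfl⟩
    exact ⟨x + y, B.add_mem hx hy, cval_add P x y⟩
  one_mem' := ⟨0, B.zero_mem, cval_zero P⟩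
  inv_mem' := by
    rintro _ ⟨x, hx, rfl⟩
    exact ⟨-x, B.neg_mem hx, cval_neg P x⟩

theorem mem_ofSub {B : Submodule (MonoidAlgebra ℤ G) (CMod P)} {x : CMod P} :
    cval P x ∈ ofSub P B ↔ x ∈ B :=
  ⟨fun ⟨_, hy, h⟩ => cval_inj P h ▸ hy, fun h => ⟨x, h, rfl⟩⟩

theorem ofSub_normal (B : Submodule (MonoidAlgebra ℤ G) (CMod P)) : (ofSub P B).Normal := by
  constructor
  rintro _ ⟨x, hx, rfl⟩ g
  exact ⟨MonoidAlgebra.of ℤ G g • x, B.smul_mem _ hx, cval_smul P g x⟩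

theorem ofSub_le (B : Submodule (MonoidAlgebra ℤ G) (CMod P)) : ofSub P B ≤ P := by
  rintro _ ⟨x, hx, rfl⟩
  exact cval_mem P x

theorem modGen_CMod_iff (k : ℕ) : ModGen (MonoidAlgebra ℤ G) k (CMod P) ↔
    NormallyKGenerated P k := by
  constructor
  · rintro ⟨a, ha⟩
    refine ⟨fun i => cval P (a i), fun i => cval_mem P _, ?_⟩
    apply le_antisymm
    · apply Subgroup.normalClosure_le_normal
      rintro _ ⟨i, rfl⟩
      exact cval_mem P _
    · have h : Submodule.span (MonoidAlgebra ℤ G) (Set.range a) ≤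
          toSub P (Subgroup.normalClosure (Set.range fun i => cval P (a i)))
            Subgroup.normalClosure_normal := by
        rw [Submodule.span_le]
        rintro _ ⟨i, rfl⟩
        exact Subgroup.subset_normalClosure ⟨i, rfl⟩
      rw [ha] at h
      intro x hx
      have := h (show cmk P ⟨x, hx⟩ ∈ ⊤ from trivial)
      rw [mem_toSub, cval_cmk] at this
      exact this
  · rintro ⟨f, hf, hc⟩
    refine ⟨fun i => cmk P ⟨f i, hf i⟩, ?_⟩
    set B := Submodule.span (MonoidAlgebra ℤ G) (Set.range fun i => cmk P ⟨f i, hf i⟩) with hB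
    have := ofSub_normal P B
    have h : P ≤ ofSub P B := by
      refine hc.symm.le.trans ?_
      apply Subgroup.normalClosure_le_normal
      rintro _ ⟨i, rfl⟩
      exact ⟨cmk P ⟨f i, hf i⟩, Submodule.subset_span ⟨i, rfl⟩, cval_cmk P _⟩
    rw [eq_top_iff]
    rintro x -
    exact (mem_ofSub P).1 (h (cval_mem P x))

theorem cmk_conj (g : G) (a : P) :
    cmk P (MulAut.conjNormal g a) = MonoidAlgebra.of ℤ G g • cmk P a := by
  apply cval_inj
  rw [cval_smul, cval_cmk, cval_cmk, MulAut.conjNormal_apply]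

theorem cmk_mul (a b : P) : cmk P (a * b) = cmk P a + cmk P b := by
  apply cval_inj
  rw [cval_add, cval_cmk, cval_cmk, cval_cmk]; rfl

theorem cmk_one : cmk P 1 = 0 := by
  apply cval_inj
  rw [cval_zero, cval_cmk]; rfl

theorem cval_eq_one {x : CMod P} (h : cval P x = 1) : x = 0 := by
  apply cval_inj
  rw [h, cval_zero]

theorem modSep_CMod_iff (k : ℕ) (F : Type) [Field F] :
    ModSep (MonoidAlgebra ℤ G) (Additive Fˣ) k (CMod P) ↔
    ∃ χ : Fin k → (P →* Fˣ), ∀ a : P, (∀ i (g : G), χ i (MulAut.conjNormal g a) = 1) → a = 1 := by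
  constructor
  · rintro ⟨χ, hχ⟩
    refine ⟨fun i =>
      { toFun := fun a => (χ i (cmk P a)).toMul
        map_one' := by simp [cmk_one]
        map_mul' := fun a b => by simp [cmk_mul] }, fun a ha => ?_⟩
    let S : AddSubgroup (CMod P) :=
      { carrier := {x | ∀ i g, χ i (MonoidAlgebra.of ℤ G g • x) = 0}
        add_mem' := fun {x y} hx hy i g => by rw [smul_add, map_add, hx i g, hy i g, add_zero]
        zero_mem' := fun i g => by rw [smul_zero, map_zero]
        neg_mem' := fun {x} hx i g => by rw [smul_neg, map_neg, hx i g, neg_zero] }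
    let B : Submodule (MonoidAlgebra ℤ G) (CMod P) :=
      { S with
        smul_mem' := fun r x hx => smul_mem_of_conj S (fun h x hx i g => by
          rw [← mul_smul, ← map_mul]; exact hx i _) r x hx }
    have hB : B = ⊥ := hχ B (fun i b hb => by
      have := hb i 1
      rwa [map_one, one_smul] at this)
    have h1 : cmk P a ∈ B := by
      intro i g
      have := ha i g
      rw [← cmk_conj]
      exact Additive.toMul.injective this
    rw [hB, Submodule.mem_bot] at h1
    have h2 := cval_cmk P a
    rw [h1, cval_zero] at h2
    exact Subtype.ext h2.symm
  · rintro ⟨χ, hχ⟩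
    refine ⟨fun i =>
      { toFun := fun x => Additive.ofMul (χ i ⟨cval P x, cval_mem P x⟩)
        map_zero' := by
          have : (⟨cval P 0, cval_mem P 0⟩ : P) = 1 := Subtype.ext (cval_zero P)
          rw [this, map_one]; rfl
        map_add' := fun x y => by
          have : (⟨cval P (x + y), cval_mem P _⟩ : P) = ⟨cval P x, cval_mem P x⟩ *
            ⟨cval P y, cval_mem P y⟩ := Subtype.ext (cval_add P x y)
          rw [this, map_mul]; rfl }, fun B hB => ?_⟩
    rw [eq_bot_iff]
    intro b hb
    rw [Submodule.mem_bot]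
    have := hχ ⟨cval P b, cval_mem P b⟩ (fun i g => by
      have h1 := hB i (MonoidAlgebra.of ℤ G g • b) (B.smul_mem _ hb)
      have h2 : MulAut.conjNormal g (⟨cval P b, cval_mem P b⟩ : P) =
          ⟨cval P (MonoidAlgebra.of ℤ G g • b), cval_mem P _⟩ := by
        apply Subtype.ext
        rw [MulAut.conjNormal_apply]
        exact (cval_smul P g b).symm
      rw [h2]
      exact Additive.ofMul.injective h1)
    exact cval_eq_one P (congrArg Subtype.val this)

theorem semisimple_of_le {A : Subgroup G} [A.Normal] [IsMulCommutative A] (h : A ≤ P)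
    (hs : IsSemisimpleModule (MonoidAlgebra ℤ G) (CMod P)) :
    IsSemisimpleModule (MonoidAlgebra ℤ G) (CMod A) := by
  let f0 : CMod A →+ CMod P :=
    { toFun := fun x => cmk P ⟨cval A x, h (cval_mem A x)⟩
      map_zero' := cval_eq_one P (by rw [cval_cmk]; exact cval_zero A)
      map_add' := fun x y => cval_inj P (by
        rw [cval_add P, cval_cmk, cval_cmk, cval_cmk]; exact cval_add A x y) }
  let f : CMod A →ₗ[MonoidAlgebra ℤ G] CMod P :=
    { f0 with
      map_smul' := fun r x => by
        show f0 (r • x) = r • f0 x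
        induction r using MonoidAlgebra.induction_on with
        | of g =>
          apply cval_inj
          rw [cval_smul]
          show cval P (cmk P _) = _ * cval P (cmk P _) * _
          rw [cval_cmk, cval_cmk]
          exact cval_smul A g x
        | add a b ha hb => rw [add_smul, add_smul, map_add, ha, hb]
        | smul n a ha => 
          rw [zsmul_eq_mul, mul_smul, mul_smul, Int.cast_smul_eq_zsmul, Int.cast_smul_eq_zsmul,
            map_zsmul, ha] }
  apply IsSemisimpleModule.of_injective f
  intro x y hxy
  have h1 : cval P (f x) = cval P (f y) := by rw [hxy]
  apply cval_inj
  have h2 : ∀ z, cval P (f z) = cval A z := fun z => cval_cmk P _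
  rwa [h2, h2] at h1

theorem simple_toSub {K : Subgroup G} (hK : IsMinimalNormal K) (hKP : K ≤ P) :
    IsSimpleModule (MonoidAlgebra ℤ G) (toSub P K hK.1) := by
  rw [isSimpleModule_iff_isAtom]
  constructor
  · intro h
    apply hK.2.1
    rw [eq_bot_iff]
    intro x hx
    have h1 : cmk P ⟨x, hKP hx⟩ ∈ toSub P K hK.1 := by
      rw [mem_toSub, cval_cmk]; exact hx
    rw [h, Submodule.mem_bot] at h1
    have h2 := cval_cmk P ⟨x, hKP hx⟩
    rw [h1, cval_zero] at h2
    exact h2.symm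
  · intro B hB
    by_contra hne
    apply hB.not_ge
    have h1 : ofSub P B = K := by
      apply hK.2.2 _ (ofSub_normal P B)
      · intro h
        apply hne
        rw [eq_bot_iff]
        intro b hb
        have : cval P b ∈ ofSub P B := (mem_ofSub P).2 hb
        rw [h] at this
        exact cval_eq_one P this
      · rintro _ ⟨x, hx, rfl⟩
        exact hB.le hx
    intro x hx
    rw [mem_toSub, ← h1] at hx
    exact (mem_ofSub P).1 hx

theorem semisimple_of_sSup (s : Set (Subgroup G)) (hs : ∀ M ∈ s, IsMinimalNormal M)
    (hP : P = sSup s) : IsSemisimpleModule (MonoidAlgebra ℤ G) (CMod P) := by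
  apply IsSemisimpleModule.of_sSup_simples_eq_top
  set B := sSup {m : Submodule (MonoidAlgebra ℤ G) (CMod P) |
    IsSimpleModule (MonoidAlgebra ℤ G) m} with hB
  have h1 : P ≤ ofSub P B := by
    refine hP.le.trans (sSup_le fun M hM => ?_)
    have hMP : M ≤ P := hP ▸ le_sSup hM
    have h2 : toSub P M (hs M hM).1 ≤ B := le_sSup (simple_toSub P (hs M hM) hMP)
    intro x hx
    have h3 : cmk P ⟨x, hMP hx⟩ ∈ toSub P M (hs M hM).1 := by
      rw [mem_toSub, cval_cmk]; exact hx
    have h4 := (mem_ofSub P).2 (h2 h3)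
    rwa [cval_cmk] at h4
  rw [eq_top_iff]
  rintro x -
  exact (mem_ofSub P).1 (h1 (cval_mem P x))

theorem card_addHom_units {F : Type} [Field F] [IsAlgClosed F] (M : Type) [AddCommGroup M]
    [Finite M] (h : ¬ ringChar F ∣ Nat.card M) : Nat.card (M →+ Additive Fˣ) = Nat.card M := by
  have h0 : ((Monoid.exponent (Multiplicative M) : ℕ) : F) ≠ 0 := by
    intro h1
    apply h
    rw [← CharP.cast_eq_zero_iff F (ringChar F)]
    have h2 : Monoid.exponent (Multiplicative M) ∣ Nat.card (Multiplicative M) :=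
      Group.exponent_dvd_nat_card
    obtain ⟨c, hc⟩ := h2
    have h3 : Nat.card M = Nat.card (Multiplicative M) := rfl
    rw [h3, hc, Nat.cast_mul, h1, zero_mul]
  have : NeZero ((Monoid.exponent (Multiplicative M) : ℕ) : F) := ⟨h0⟩
  have h1 := CommGroup.card_monoidHom_of_hasEnoughRootsOfUnity (Multiplicative M) F
  rw [← Nat.card_congr (AddMonoidHom.toMultiplicativeLeft (α := M) (β := Fˣ))] at h1
  exact h1

theorem group_duality [Finite G] (k : ℕ) (F : Type) [Field F] [IsAlgClosed F]
    (hchar : ¬ ringChar F ∣ Nat.card P)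
    (hss : IsSemisimpleModule (MonoidAlgebra ℤ G) (CMod P)) :
    NormallyKGenerated P k ↔
    ∃ χ : Fin k → (P →* Fˣ), ∀ a : P, (∀ i (g : G), χ i (MulAut.conjNormal g a) = 1) → a = 1 := by
  have hfin : Finite (CMod P) := inferInstanceAs (Finite P)
  have hcard : Nat.card (CMod P) = Nat.card P := rfl
  rw [← modGen_CMod_iff, ← modSep_CMod_iff]
  exact modGen_iff_modSep (Additive Fˣ) k _ (CMod P) rfl
    (fun M _ _ hM => card_addHom_units M (fun h => hchar (h.trans (hcard ▸ hM))))

end ConjModule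

section GroupLemmas

variable {G : Type} [Group G]

/-- Nonabelian minimal normal subgroups. -/
def NonabMin (M : Subgroup G) : Prop :=
  IsMinimalNormal M ∧ ¬ ∀ x ∈ M, ∀ y ∈ M, x * y = y * x

theorem minNormal_commute_normal {M K : Subgroup G} (hM : IsMinimalNormal M) (hK : K.Normal)
    (h : ¬ M ≤ K) {x y : G} (hx : x ∈ M) (hy : y ∈ K) : x * y = y * x := by
  have hMn := hM.1
  have hd : Disjoint M K := by
    rw [disjoint_iff]
    by_contra hne
    have := hM.2.2 (M ⊓ K) inferInstance hne inf_le_left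
    exact h (this ▸ inf_le_right)
  exact Subgroup.commute_of_normal_of_disjoint M K hM.1 hK hd x y hx hy

theorem minNormal_commute {M K : Subgroup G} (hM : IsMinimalNormal M) (hK : IsMinimalNormal K)
    (h : M ≠ K) {x y : G} (hx : x ∈ M) (hy : y ∈ K) : x * y = y * x := by
  apply minNormal_commute_normal hM hK.1 _ hx hy
  intro hle
  exact h (hK.2.2 M hM.1 hM.2.1 hle)

theorem sSup_commute {s s' : Set (Subgroup G)}
    (h : ∀ M ∈ s, ∀ K ∈ s', ∀ x ∈ M, ∀ y ∈ K, x * y = y * x) {x y : G}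
    (hx : x ∈ sSup s) (hy : y ∈ sSup s') : x * y = y * x := by
  have h1 : ∀ M ∈ s, sSup s' ≤ Subgroup.centralizer (M : Set G) := by
    intro M hM
    refine sSup_le fun K hK => ?_
    intro y hy
    rw [Subgroup.mem_centralizer_iff]
    intro x hx
    exact h M hM K hK x hx y hy
  have h2 : sSup s ≤ Subgroup.centralizer (sSup s' : Subgroup G) := by
    refine sSup_le fun M hM => ?_
    rw [Subgroup.le_centralizer_iff]
    exact h1 M hM
  have := h2 hx
  rw [Subgroup.mem_centralizer_iff] at this
  exact (this y hy).symm

theorem aSocle_commute {x y : G} (hx : x ∈ aSocle G) (hy : y ∈ aSocle G) : x * y = y * x := by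
  refine sSup_commute ?_ hx hy
  rintro M ⟨hM, hMa⟩ K ⟨hK, -⟩ x hx y hy
  by_cases h : M = K
  · subst h; exact hMa x hx y hy
  · exact minNormal_commute hM hK h hx hy

theorem aSocle_commute_nonab {M : Subgroup G} (hM : NonabMin M) {x y : G} (hx : x ∈ aSocle G)
    (hy : y ∈ M) : x * y = y * x := by
  refine sSup_commute (s' := {M}) ?_ hx (by simpa using hy)
  rintro K ⟨hK, hKa⟩ _ rfl x hx y hy
  refine minNormal_commute hK hM.1 ?_ hx hy
  rintro rfl
  exact hM.2 hKa

theorem aSocle_normal : (aSocle G).Normal := Subgroup.sSup_normal _ fun _ h => h.1.1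

theorem socle_normal : (socle G).Normal := Subgroup.sSup_normal _ fun _ h => h.1

theorem nonab_center {M : Subgroup G} (hM : NonabMin M) {x : G} (hx : x ∈ M)
    (h : ∀ y ∈ M, x * y = y * x) : x = 1 := by
  by_contra hne
  have hMn := hM.1.1
  have hc : (Subgroup.centralizer (M : Set G)).Normal := inferInstance
  have h1 : M ⊓ Subgroup.centralizer (M : Set G) = M := by
    apply hM.1.2.2 _ inferInstance _ inf_le_left
    intro hb
    have : x ∈ M ⊓ Subgroup.centralizer (M : Set G) :=
      ⟨hx, Subgroup.mem_centralizer_iff.2 fun y hy => (h y hy).symm⟩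
    rw [hb] at this
    exact hne this
  apply hM.2
  intro a ha b hb
  rw [← h1] at hb
  exact Subgroup.mem_centralizer_iff.1 hb.2 a ha

theorem sSup_insert_mem {M : Subgroup G} {s : Set (Subgroup G)} (hM : M.Normal) {x : G}
    (hx : x ∈ sSup (insert M s)) : ∃ m ∈ M, ∃ y ∈ sSup s, m * y = x := by
  rw [sSup_insert] at hx
  rw [Subgroup.mem_sup_of_normal_left] at hx
  exact hx

theorem nonab_sSup_commute {M : Subgroup G} {s : Set (Subgroup G)} (hM : NonabMin M)
    (hs : ∀ K ∈ s, NonabMin K) (hMs : M ∉ s) {x y : G} (hx : x ∈ M) (hy : y ∈ sSup s) :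
    x * y = y * x := by
  refine sSup_commute (s := {M}) ?_ (by simpa using hx) hy
  rintro _ rfl K hK x hx y hy
  refine minNormal_commute hM.1 (hs K hK).1 ?_ hx hy
  rintro rfl
  exact hMs hK

theorem sSup_center_trivial {s : Set (Subgroup G)} (hfin : s.Finite)
    (hs : ∀ K ∈ s, NonabMin K) : ∀ x ∈ sSup s, (∀ M ∈ s, ∀ y ∈ M, x * y = y * x) → x = 1 := by
  induction s, hfin using Set.Finite.induction_on with
  | empty => intro x hx _; simpa using hx
  | @insert M s hMs _ ih =>
    intro x hx hc
    have hM := hs M (Set.mem_insert _ _)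
    have hs' : ∀ K ∈ s, NonabMin K := fun K hK => hs K (Set.mem_insert_of_mem _ hK)
    obtain ⟨m, hm, y, hy, rfl⟩ := sSup_insert_mem hM.1.1 hx
    have hm1 : m = 1 := by
      apply nonab_center hM hm
      intro z hz
      have h1 := hc M (Set.mem_insert _ _) z hz
      have h2 := nonab_sSup_commute hM hs' hMs hz hy
      rw [mul_assoc, ← h2, ← mul_assoc, ← mul_assoc] at h1
      exact mul_right_cancel h1
    subst hm1
    rw [one_mul] at hc ⊢
    exact ih hs' y hy fun K hK => hc K (Set.mem_insert_of_mem _ hK)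

theorem exists_noncommuting {s : Set (Subgroup G)} (hfin : s.Finite)
    (hs : ∀ K ∈ s, NonabMin K) : ∃ t ∈ sSup s, ∀ M ∈ s, ∃ y ∈ M, t * y ≠ y * t := by
  induction s, hfin using Set.Finite.induction_on with
  | empty => exact ⟨1, one_mem _, by simp⟩
  | @insert M s hMs _ ih =>
    have hM := hs M (Set.mem_insert _ _)
    have hs' : ∀ K ∈ s, NonabMin K := fun K hK => hs K (Set.mem_insert_of_mem _ hK)
    obtain ⟨t, ht, htc⟩ := ih hs'
    obtain ⟨m, hm, y, hy, hne⟩ : ∃ m ∈ M, ∃ y ∈ M, m * y ≠ y * m := by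
      have := hM.2; push Not at this; exact this
    have hle : sSup s ≤ sSup (insert M s) := sSup_le_sSup (Set.subset_insert _ _)
    have hle' : M ≤ sSup (insert M s) := le_sSup (Set.mem_insert _ _)
    refine ⟨m * t, mul_mem (hle' hm) (hle ht), ?_⟩
    rintro K (rfl | hK)
    · refine ⟨y, hy, fun h => hne ?_⟩
      rw [mul_assoc, ← nonab_sSup_commute hM hs' hMs hy ht, ← mul_assoc, ← mul_assoc] at h
      exact mul_right_cancel h
    · obtain ⟨z, hz, hzt⟩ := htc K hK
      refine ⟨z, hz, fun h => hzt ?_⟩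
      rw [← mul_assoc, ← nonab_sSup_commute hM hs' hMs hm (le_sSup hK hz), mul_assoc,
        mul_assoc] at h
      exact mul_left_cancel h

theorem exists_minNormal_le [Finite G] {K : Subgroup G} (hK : K.Normal) (hne : K ≠ ⊥) :
    ∃ M ≤ K, IsMinimalNormal M := by
  obtain ⟨M, ⟨h1, h2, h3⟩, hmin⟩ :=
    (wellFounded_lt : WellFounded ((· < ·) : Subgroup G → Subgroup G → Prop)).has_min
      {M | M ≤ K ∧ M.Normal ∧ M ≠ ⊥} ⟨K, le_rfl, hK, hne⟩
  refine ⟨M, h1, h2, h3, fun L hL hLne hLM => ?_⟩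
  by_contra hne'
  exact hmin L ⟨hLM.trans h1, hL, hLne⟩ (lt_of_le_of_ne hLM hne')

theorem nonab_exists_elt [Finite G] (F : Type) [Field F] {M : Subgroup G} (hM : NonabMin M) :
    ∃ t ∈ M, t ≠ 1 ∧ ((orderOf t : ℕ) : F) ≠ 0 := by
  by_contra hcon
  push Not at hcon
  have hMne : Nontrivial M := by
    rw [Subgroup.nontrivial_iff_ne_bot]; exact hM.1.2.1
  rcases CharP.char_is_prime_or_zero F (ringChar F) with hp | hp
  · have : Fact (ringChar F).Prime := ⟨hp⟩
    have hpg : IsPGroup (ringChar F) M := by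
      intro ⟨g, hg⟩
      set n := orderOf g with hn
      have hn0 : n ≠ 0 := (orderOf_pos g).ne'
      refine ⟨n.factorization (ringChar F), ?_⟩
      apply Subtype.ext
      show g ^ _ = 1
      by_contra hne
      have h1 := hcon _ (M.pow_mem hg _) hne
      rw [orderOf_pow_of_dvd (pow_ne_zero _ hp.ne_zero) (Nat.ordProj_dvd n _),
        CharP.cast_eq_zero_iff F (ringChar F)] at h1
      exact Nat.not_dvd_ordCompl hp hn0 h1
    have := hpg.center_nontrivial
    obtain ⟨⟨⟨x, hx⟩, hxc⟩, hx1⟩ := exists_ne (1 : Subgroup.center M)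
    apply hx1
    apply Subtype.ext
    apply Subtype.ext
    apply nonab_center hM hx
    intro y hy
    have := Subgroup.mem_center_iff.1 hxc ⟨y, hy⟩
    exact (congrArg Subtype.val this).symm
  · obtain ⟨⟨t, ht⟩, hne⟩ := exists_ne (1 : M)
    have h1 := hcon t ht (fun h => hne (Subtype.ext h))
    rw [CharP.cast_eq_zero_iff F (ringChar F), hp, zero_dvd_iff] at h1
    exact (orderOf_pos t).ne' h1

/-- Nonabelian minimal normal subgroups inside `N`. -/
def nonabIn (N : Subgroup G) : Set (Subgroup G) := {M | NonabMin M ∧ M ≤ N}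

theorem socle_inf_decomp [Finite G] {N : Subgroup G} (hN : N.Normal) {x : G}
    (hx : x ∈ socle G ⊓ N) : ∃ a ∈ aSocle G ⊓ N, ∃ t ∈ sSup (nonabIn N), x = a * t := by
  set T' := {M : Subgroup G | NonabMin M ∧ ¬ M ≤ N} with hT'
  have hTn : (sSup (nonabIn N)).Normal := Subgroup.sSup_normal _ fun _ h => h.1.1.1
  have hTn' : (sSup T').Normal := Subgroup.sSup_normal _ fun _ h => h.1.1.1
  have han := aSocle_normal (G := G)
  have hle : socle G ≤ (aSocle G ⊔ sSup (nonabIn N)) ⊔ sSup T' := by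
    refine sSup_le fun M hM => ?_
    by_cases h1 : ∀ x ∈ M, ∀ y ∈ M, x * y = y * x
    · exact le_trans (le_trans (show M ≤ aSocle G from le_sSup ⟨hM, h1⟩) le_sup_left) le_sup_left
    · by_cases h2 : M ≤ N
      · exact le_trans (le_trans (show M ≤ sSup (nonabIn N) from le_sSup ⟨⟨hM, h1⟩, h2⟩) le_sup_right) le_sup_left
      · exact le_trans (show M ≤ sSup T' from le_sSup ⟨⟨hM, h1⟩, h2⟩) le_sup_right
  obtain ⟨hxs, hxN⟩ := hx
  have h1 := hle hxs
  rw [Subgroup.mem_sup_of_normal_right] at h1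
  obtain ⟨y, hy, t', ht', rfl⟩ := h1
  rw [Subgroup.mem_sup_of_normal_right] at hy
  obtain ⟨a, ha, t, ht, rfl⟩ := hy
  have hTN : sSup (nonabIn N) ≤ N := sSup_le fun M h => h.2
  have ht1 : t' = 1 := by
    refine sSup_center_trivial (Set.toFinite T') (fun K h => h.1) t' ht' ?_
    intro M hM y hy
    have c1 : y * (a * t * t') = (a * t * t') * y :=
      minNormal_commute_normal hM.1.1 hN hM.2 hy hxN
    have c2 : a * y = y * a := aSocle_commute_nonab hM.1 ha hy
    have c3 : y * t = t * y := minNormal_commute_normal hM.1.1 hN hM.2 hy (hTN ht)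
    have c4 : y * (a * t) = (a * t) * y := by
      rw [← mul_assoc, ← c2, mul_assoc, c3, mul_assoc]
    rw [← mul_assoc, c4, mul_assoc, mul_assoc (a * t)] at c1
    exact (mul_left_cancel c1).symm
  subst ht1
  rw [mul_one] at hxN ⊢
  refine ⟨a, ⟨ha, ?_⟩, t, ht, rfl⟩
  have := N.mul_mem hxN (N.inv_mem (hTN ht))
  simpa using this

theorem aSocle_le_socle : aSocle G ≤ socle G := sSup_le_sSup fun _ h => h.1

theorem gen_aSocle_of_gen_socle [Finite G] {N : Subgroup G} (hN : N.Normal) {k : ℕ}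
    (h : NormallyKGenerated (socle G ⊓ N) k) : NormallyKGenerated (aSocle G ⊓ N) k := by
  obtain ⟨f, hf, hc⟩ := h
  have han := aSocle_normal (G := G)
  have hTn : (sSup (nonabIn N)).Normal := Subgroup.sSup_normal _ fun _ h => h.1.1.1
  choose a ha t ht hat using fun i => socle_inf_decomp hN (hf i)
  have hBle : Subgroup.normalClosure (Set.range a) ≤ aSocle G ⊓ N := by
    apply Subgroup.normalClosure_le_normal
    rintro _ ⟨i, rfl⟩
    exact ha i
  refine ⟨a, ha, le_antisymm hBle ?_⟩
  have h1 : socle G ⊓ N ≤ Subgroup.normalClosure (Set.range a) ⊔ sSup (nonabIn N) := by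
    rw [← hc]
    apply Subgroup.normalClosure_le_normal
    rintro _ ⟨i, rfl⟩
    rw [SetLike.mem_coe, hat i]
    exact Subgroup.mul_mem_sup (Subgroup.subset_normalClosure ⟨i, rfl⟩) (ht i)
  intro x hx
  have h2 := h1 ⟨aSocle_le_socle hx.1, hx.2⟩
  rw [Subgroup.mem_sup_of_normal_right] at h2
  obtain ⟨b, hb, u, hu, rfl⟩ := h2
  have hua : u ∈ aSocle G := by
    have := (aSocle G).mul_mem ((aSocle G).inv_mem (hBle hb).1) hx.1
    simpa using this
  have : u = 1 := sSup_center_trivial (Set.toFinite _) (fun K h => h.1) u hu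
    (fun M hM y hy => aSocle_commute_nonab hM.1 hua hy)
  rw [this, mul_one]
  exact hb

theorem gen_socle_of_gen_aSocle [Finite G] {N : Subgroup G} (hN : N.Normal) {k : ℕ} (hk : 1 ≤ k)
    (h : NormallyKGenerated (aSocle G ⊓ N) k) : NormallyKGenerated (socle G ⊓ N) k := by
  obtain ⟨a, ha, hc⟩ := h
  have hsn := socle_normal (G := G)
  obtain ⟨t, ht, htc⟩ := exists_noncommuting (Set.toFinite (nonabIn N)) (fun K h => h.1)
  have hTle : sSup (nonabIn N) ≤ socle G ⊓ N :=
    sSup_le fun M hM => le_inf (le_sSup hM.1.1) hM.2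
  have hAle : aSocle G ⊓ N ≤ socle G ⊓ N := inf_le_inf_right _ aSocle_le_socle
  let i0 : Fin k := ⟨0, hk⟩
  let f : Fin k → G := fun i => if i = i0 then a i * t else a i
  have hf : ∀ i, f i ∈ socle G ⊓ N := by
    intro i
    by_cases hi : i = i0
    · simp only [f, hi, if_true]; exact mul_mem (hAle (ha _)) (hTle ht)
    · simp only [f, hi, if_false]; exact hAle (ha _)
  refine ⟨f, hf, le_antisymm ?_ ?_⟩
  · apply Subgroup.normalClosure_le_normal
    rintro _ ⟨i, rfl⟩
    exact hf i
  · set D := Subgroup.normalClosure (Set.range f) with hD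
    have hDn : D.Normal := Subgroup.normalClosure_normal
    have hfD : ∀ i, f i ∈ D := fun i => Subgroup.subset_normalClosure ⟨i, rfl⟩
    have h0 : a i0 * t ∈ D := by simpa [f] using hfD i0
    have hTD : sSup (nonabIn N) ≤ D := by
      refine sSup_le fun M hM => ?_
      by_contra hnot
      obtain ⟨y, hy, hne⟩ := htc M hM
      apply hne
      have c1 := minNormal_commute_normal hM.1.1 hDn hnot hy h0
      have c2 := aSocle_commute_nonab hM.1 (ha i0).1 hy
      rw [← mul_assoc, ← c2, mul_assoc, mul_assoc] at c1
      exact (mul_left_cancel c1).symm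
    have haD : ∀ i, a i ∈ D := by
      intro i
      by_cases hi : i = i0
      · subst hi
        have := D.mul_mem h0 (D.inv_mem (hTD ht))
        simpa using this
      · simpa [f, hi] using hfD i
    have hAD : aSocle G ⊓ N ≤ D := by
      rw [← hc]
      apply Subgroup.normalClosure_le_normal
      rintro _ ⟨i, rfl⟩
      exact haD i
    intro x hx
    obtain ⟨b, hb, u, hu, rfl⟩ := socle_inf_decomp hN hx
    exact D.mul_mem (hAD hb) (hTD hu)

open scoped IsMulCommutative in
theorem exists_char_data [Finite G] (F : Type) [Field F] [IsAlgClosed F] (A : Subgroup G)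
    (hA : A ≤ aSocle G) (hcard : ((Nat.card A : ℕ) : F) ≠ 0) (χ : A →* Fˣ)
    (s : Set (Subgroup G)) (hfin : s.Finite) (hs : ∀ K ∈ s, NonabMin K) :
    ∃ (Q : Type) (_ : CommGroup Q) (_ : Finite Q) (φ : Q →* G) (ψ : Q →* Fˣ) (ι : A → Q),
      Function.Injective φ ∧ ((Nat.card Q : ℕ) : F) ≠ 0 ∧ (∀ q, φ q ∈ aSocle G ⊔ sSup s) ∧
      (∀ a, φ (ι a) = a) ∧ (∀ a, ψ (ι a) = χ a) ∧ ∀ M ∈ s, ∃ q, φ q ∈ M ∧ ψ q ≠ 1 := by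
  induction s, hfin using Set.Finite.induction_on with
  | empty =>
    let _ : CommGroup A := { (inferInstance : Group A) with
      mul_comm := fun a b => Subtype.ext (aSocle_commute (hA a.2) (hA b.2)) }
    exact ⟨A, inferInstance, inferInstance, A.subtype, χ, id, A.subtype_injective, hcard,
      fun q => le_sup_left (a := aSocle G) (hA q.2), fun _ => rfl, fun _ => rfl, by simp⟩
  | @insert M s hMs hsf ih =>
    have hM := hs M (Set.mem_insert _ _)
    have hs' : ∀ K ∈ s, NonabMin K := fun K hK => hs K (Set.mem_insert_of_mem _ hK)
    obtain ⟨Q, _, _, φ, ψ, ι, hinj, hc, hr, h1, h2, h3⟩ := ih hs'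
    obtain ⟨t, ht, ht1, hto⟩ := nonab_exists_elt F hM
    have han := aSocle_normal (G := G)
    have hcommM : ∀ x ∈ M, ∀ y ∈ aSocle G ⊔ sSup s, x * y = y * x := by
      intro x hx y hy
      rw [Subgroup.mem_sup_of_normal_left] at hy
      obtain ⟨a, ha, u, hu, rfl⟩ := hy
      rw [← mul_assoc, ← aSocle_commute_nonab hM ha hx, mul_assoc,
        nonab_sSup_commute hM hs' hMs hx hu, mul_assoc]
    have hzM : Subgroup.zpowers t ≤ M := by simpa using ht
    have hcomm : ∀ (q : Q) (z : Subgroup.zpowers t),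
        Commute (φ q) ((Subgroup.zpowers t).subtype z) := fun q z =>
      (hcommM z (hzM z.2) _ (hr q)).symm
    have hcz : Nat.card (Subgroup.zpowers t) = orderOf t := Nat.card_zpowers t
    have : NeZero ((Monoid.exponent (Subgroup.zpowers t) : ℕ) : F) := ⟨by
      intro h
      apply hto
      obtain ⟨c, hc⟩ := Group.exponent_dvd_nat_card (G := Subgroup.zpowers t)
      rw [← hcz, hc, Nat.cast_mul, h, zero_mul]⟩
    let z0 : Subgroup.zpowers t := ⟨t, Subgroup.mem_zpowers t⟩
    have hz0 : z0 ≠ 1 := fun h => ht1 (congrArg Subtype.val h)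
    obtain ⟨η, hη⟩ := CommGroup.exists_apply_ne_one_of_hasEnoughRootsOfUnity
      (Subgroup.zpowers t) F hz0
    have hle : aSocle G ⊔ sSup s ≤ aSocle G ⊔ sSup (insert M s) :=
      sup_le_sup_left (sSup_le_sSup (Set.subset_insert _ _)) _
    have hle' : M ≤ aSocle G ⊔ sSup (insert M s) :=
      le_trans (le_sSup (Set.mem_insert _ _)) le_sup_right
    refine ⟨Q × Subgroup.zpowers t, inferInstance, inferInstance,
      MonoidHom.noncommCoprod φ (Subgroup.zpowers t).subtype hcomm, ψ.coprod η,
      fun a => (ι a, 1), ?_, ?_, ?_, ?_, ?_, ?_⟩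
    · rw [injective_iff_map_eq_one]
      rintro ⟨q, z⟩ hqz
      have hqz : φ q * z = 1 := hqz
      have hz : (z : G) = (φ q)⁻¹ := (inv_eq_of_mul_eq_one_right hqz).symm
      have hz1 : (z : G) = 1 := by
        apply nonab_center hM (hzM z.2)
        intro y hy
        rw [hz]
        exact (hcommM y hy _ (inv_mem (hr q))).symm
      rw [hz1, mul_one] at hqz
      have hq : q = 1 := hinj (by rw [hqz, map_one])
      rw [hq]
      exact Prod.ext rfl (Subtype.ext hz1)
    · rw [Nat.card_prod, Nat.cast_mul, hcz]
      exact mul_ne_zero hc hto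
    · rintro ⟨q, z⟩
      exact mul_mem (hle (hr q)) (hle' (hzM z.2))
    · intro a; simp [h1]
    · intro a; simp [h2]
    · rintro K (rfl | hK)
      · refine ⟨(1, z0), ?_, ?_⟩
        · simpa [z0] using ht
        · simpa using hη
      · obtain ⟨q, hq, hq'⟩ := h3 K hK
        exact ⟨(q, 1), by simpa using hq, by simpa using hq'⟩

end GroupLemmas

section RepLemmas

/-- Intermediate condition: `k` maximal left ideals of `F[G]` whose simple quotients are jointly
faithful on `N`. -/
def SimpleFaithful (F : Type) [Field F] (N : Subgroup G) (k : ℕ) : Prop :=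
  ∃ J : Fin k → Ideal (MonoidAlgebra F G), (∀ i, (J i).IsMaximal) ∧
    ∀ g ∈ N, (∀ i x, MonoidAlgebra.of F G g * x - x ∈ J i) → g = 1

theorem exists_maximal_weight (F : Type) [Field F] {Q : Type} [CommGroup Q] [Finite Q]
    (φ : Q →* G) (hφ : Function.Injective φ) (ψ : Q →* Fˣ) (hc : (Nat.card Q : F) ≠ 0) :
    ∃ J : Ideal (MonoidAlgebra F G), J.IsMaximal ∧ ∃ x, x ∉ J ∧
      ∀ q, MonoidAlgebra.of F G (φ q) * x = ((ψ q : Fˣ) : F) • x := by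
  classical
  have := Fintype.ofFinite Q
  let e : MonoidAlgebra F G := ∑ q : Q, ((ψ q)⁻¹ : Fˣ).val • MonoidAlgebra.of F G (φ q)
  have he : ∀ q, MonoidAlgebra.of F G (φ q) * e = ((ψ q : Fˣ) : F) • e := by
    intro q
    simp only [e, Finset.mul_sum, Finset.smul_sum, mul_smul_comm, ← map_mul, smul_smul]
    refine Fintype.sum_equiv (Equiv.mulLeft q) _ _ fun r => ?_
    have h : ψ q * (ψ (q * r))⁻¹ = (ψ r)⁻¹ := by rw [map_mul, mul_inv_rev, mul_comm (ψ r)⁻¹, mul_inv_cancel_left]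
    rw [Equiv.coe_mulLeft, ← Units.val_mul, h]
  have hee : e * e = (Nat.card Q : F) • e := by
    conv_lhs => enter [1]; simp only [e]
    rw [Finset.sum_mul]
    simp only [smul_mul_assoc, he, smul_smul]
    simp [Nat.cast_smul_eq_nsmul]
  have hne : e ≠ 0 := by
    intro h0
    have h1 : e.coeff 1 = 1 := by
      have : e = ∑ q : Q, MonoidAlgebra.single (φ q) (((ψ q)⁻¹ : Fˣ).val) := by
        simp [e, MonoidAlgebra.smul_single]
      rw [this, MonoidAlgebra.coeff_sum, Finset.sum_apply',
        Finset.sum_eq_single_of_mem (1 : Q) (Finset.mem_univ _)]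
      · simp
      · intro q _ hq
        have : φ q ≠ 1 := fun h => hq (hφ (h.trans (map_one φ).symm))
        simp [this]
    rw [h0] at h1
    simp at h1
  let f : MonoidAlgebra F G := (Nat.card Q : F)⁻¹ • e
  have hf : ∀ q, MonoidAlgebra.of F G (φ q) * f = ((ψ q : Fˣ) : F) • f := by
    intro q
    simp only [f, mul_smul_comm, he]
    rw [smul_comm]
  have hff : f * f = f := by
    simp only [f, smul_mul_assoc, mul_smul_comm, hee, smul_smul]
    rw [inv_mul_cancel₀ hc, mul_one]
  have hfne : f ≠ 0 := smul_ne_zero (inv_ne_zero hc) hne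
  obtain ⟨J, hJ, hle⟩ := Ideal.exists_le_maximal (Ideal.span {1 - f}) (by
    intro htop
    have h1 : (1 : MonoidAlgebra F G) ∈ Ideal.span {1 - f} := htop ▸ Submodule.mem_top
    obtain ⟨r, hr⟩ := Ideal.mem_span_singleton'.1 h1
    apply hfne
    have : r * (1 - f) * f = f := by rw [hr, one_mul]
    rw [mul_assoc, sub_mul, hff, one_mul, sub_self, mul_zero] at this
    exact this.symm)
  refine ⟨J, hJ, f, fun hfJ => hJ.ne_top ?_, hf⟩
  rw [Ideal.eq_top_iff_one]
  have := J.add_mem (hle (Ideal.mem_span_singleton_self _)) hfJ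
  simpa using this

theorem exists_eigenvector (F : Type) [Field F] [IsAlgClosed F] (A : Type) [CommGroup A] [Finite A]
    (V : Type) [AddCommGroup V] [Module (MonoidAlgebra F A) V] [Nontrivial V] :
    ∃ (w : V) (χ : A →* Fˣ), w ≠ 0 ∧
      ∀ a, MonoidAlgebra.of F A a • w = algebraMap F (MonoidAlgebra F A) (χ a : F) • w := by
  have : Module.Finite F (MonoidAlgebra F A) := by
    infer_instance
  have : IsNoetherianRing (MonoidAlgebra F A) := isNoetherian_of_tower F inferInstance
  obtain ⟨P, hP⟩ := associatedPrimes.nonempty (MonoidAlgebra F A) V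
  obtain ⟨hPp, w, hw⟩ := isAssociatedPrime_iff.1 hP
  have hbij : Function.Bijective (algebraMap F (MonoidAlgebra F A ⧸ P)) :=
    IsAlgClosed.algebraMap_bijective_of_isIntegral
  have hmem : ∀ r, r ∈ P ↔ r • w = 0 := by
    intro r
    rw [hw, Submodule.mem_colon_singleton, Submodule.mem_bot]
  let E := RingEquiv.ofBijective _ hbij
  let χ : A →* F := (E.symm.toRingHom.comp (Ideal.Quotient.mk P)).toMonoidHom.comp
    (MonoidAlgebra.of F A)
  refine ⟨w, χ.toHomUnits, ?_, fun a => ?_⟩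
  · rintro rfl
    apply hPp.ne_top
    rw [Ideal.eq_top_iff_one, hmem, smul_zero]
  · rw [← sub_eq_zero, ← sub_smul, ← hmem, ← Ideal.Quotient.eq, MonoidHom.coe_toHomUnits]
    change _ = E (E.symm _)
    simp

theorem exists_weight_quot (F : Type) [Field F] [IsAlgClosed F] {G : Type} [Group G] [Finite G]
    (A : Subgroup G) (hA : ∀ x ∈ A, ∀ y ∈ A, x * y = y * x)
    (J : Ideal (MonoidAlgebra F G)) (hJ : J.IsMaximal) :
    ∃ (x : MonoidAlgebra F G) (χ : A →* Fˣ), x ∉ J ∧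
      ∀ a : A, MonoidAlgebra.of F G (a : G) * x - ((χ a : Fˣ) : F) • x ∈ J := by
  let _ : CommGroup A :=
    { (inferInstance : Group A) with
      mul_comm := fun a b => Subtype.ext (hA a a.2 b b.2) }
  let f : MonoidAlgebra F A →ₐ[F] MonoidAlgebra F G :=
    MonoidAlgebra.lift F _ A ((MonoidAlgebra.of F G).comp A.subtype)
  let _ : Module (MonoidAlgebra F A) (MonoidAlgebra F G ⧸ J) :=
    Module.compHom _ (f : MonoidAlgebra F A →+* MonoidAlgebra F G)
  have : Nontrivial (MonoidAlgebra F G ⧸ J) := Submodule.Quotient.nontrivial_iff.2 hJ.ne_top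
  obtain ⟨w, χ, hw, h⟩ := exists_eigenvector F A (MonoidAlgebra F G ⧸ J)
  obtain ⟨x, rfl⟩ := Submodule.Quotient.mk_surjective J w
  refine ⟨x, χ, fun hx => hw ((Submodule.Quotient.mk_eq_zero J).2 hx), fun a => ?_⟩
  have h1 := h a
  change f _ • (Submodule.Quotient.mk x : MonoidAlgebra F G ⧸ J) =
    f _ • (Submodule.Quotient.mk x : MonoidAlgebra F G ⧸ J) at h1
  rw [AlgHom.commutes, ← Submodule.Quotient.mk_smul, ← Submodule.Quotient.mk_smul,
    Submodule.Quotient.eq, smul_eq_mul, smul_eq_mul, ← Algebra.smul_def] at h1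
  simpa [f] using h1

theorem conj_trivial_span (F : Type) [Field F] {G : Type} [Group G]
    (J : Ideal (MonoidAlgebra F G)) (hJ : J.IsMaximal) (x : MonoidAlgebra F G) (hx : x ∉ J)
    (a : G) (h : ∀ g : G, MonoidAlgebra.of F G (g * a * g⁻¹) * x - x ∈ J) (y : MonoidAlgebra F G) :
    MonoidAlgebra.of F G a * y - y ∈ J := by
  have key : ∀ r : MonoidAlgebra F G, MonoidAlgebra.of F G a * (r * x) - r * x ∈ J := by
    intro r
    induction r using MonoidAlgebra.induction_on with
    | of g =>
      have h1 := J.mul_mem_left (MonoidAlgebra.of F G g) (h g⁻¹)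
      rw [mul_sub, ← mul_assoc, ← map_mul] at h1
      rw [← mul_assoc, ← map_mul]
      convert h1 using 4
      group
    | add r s hr hs =>
      have := J.add_mem hr hs
      convert this using 1
      noncomm_ring
    | smul c r hr =>
      have := J.mul_mem_left (algebraMap F _ c) hr
      rw [← Algebra.smul_def] at this
      convert this using 1
      rw [smul_sub, smul_mul_assoc, mul_smul_comm]
  have hsup : J ⊔ Ideal.span {x} = ⊤ := by
    refine hJ.1.2 _ (lt_of_le_of_ne le_sup_left fun h => hx ?_)
    rw [h]
    exact le_sup_right (a := J) (Ideal.mem_span_singleton_self x)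
  have hy : y ∈ J ⊔ Ideal.span {x} := hsup ▸ Submodule.mem_top
  obtain ⟨j, hj, z, hz, rfl⟩ := Submodule.mem_sup.1 hy
  obtain ⟨r, rfl⟩ := Ideal.mem_span_singleton'.1 hz
  have := J.add_mem (J.sub_mem (J.mul_mem_left (MonoidAlgebra.of F G a) hj) hj) (key r)
  convert this using 1
  noncomm_ring

end RepLemmas

section Kernel

/-- The subgroup of elements of `N` acting trivially on all quotients `F[G] ⧸ J i`. -/
def jKer (F : Type) [Field F] {ι : Type} (J : ι → Ideal (MonoidAlgebra F G)) (N : Subgroup G)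
    (_ : N.Normal) : Subgroup G where
  carrier := {g | g ∈ N ∧ ∀ i y, MonoidAlgebra.of F G g * y - y ∈ J i}
  one_mem' := ⟨N.one_mem, fun i y => by
    rw [map_one, one_mul, sub_self]
    exact (J i).zero_mem⟩
  mul_mem' := by
    rintro g h ⟨hg, hg'⟩ ⟨hh, hh'⟩
    refine ⟨N.mul_mem hg hh, fun i y => ?_⟩
    have := (J i).add_mem (hg' i (MonoidAlgebra.of F G h * y)) (hh' i y)
    rw [map_mul, mul_assoc]
    simpa using this
  inv_mem' := by
    rintro g ⟨hg, hg'⟩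
    refine ⟨N.inv_mem hg, fun i y => ?_⟩
    have := (J i).neg_mem (hg' i (MonoidAlgebra.of F G g⁻¹ * y))
    rw [← mul_assoc, ← map_mul, mul_inv_cancel, map_one, one_mul, neg_sub] at this
    exact this

theorem jKer_normal (F : Type) [Field F] {ι : Type} (J : ι → Ideal (MonoidAlgebra F G))
    (N : Subgroup G) (hN : N.Normal) : (jKer F J N hN).Normal := by
  constructor
  rintro g ⟨hg, hg'⟩ h
  refine ⟨hN.conj_mem g hg h, fun i y => ?_⟩
  have := (J i).mul_mem_left (MonoidAlgebra.of F G h)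
    (hg' i (MonoidAlgebra.of F G h⁻¹ * y))
  rw [mul_sub, ← mul_assoc, ← mul_assoc, ← mul_assoc, ← map_mul, ← map_mul, ← map_mul,
    mul_inv_cancel, map_one, one_mul] at this
  exact this

theorem minNormal_le_aSocle {M : Subgroup G} (hM : IsMinimalNormal M)
    (hMa : ∀ x ∈ M, ∀ y ∈ M, x * y = y * x) : M ≤ aSocle G := by
  unfold aSocle
  exact le_sSup ⟨hM, hMa⟩

end Kernel

section MainEquiv

variable {G : Type} [Group G] [Finite G] {N : Subgroup G} (F : Type) [Field F] [IsAlgClosed F]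

theorem abelian_duality (hN : N.Normal) (hchar : ¬ (ringChar F ∣ Nat.card ↥(aSocle G ⊓ N)))
    (k : ℕ) (hn : (aSocle G ⊓ N).Normal) : NormallyKGenerated (aSocle G ⊓ N) k ↔
      ∃ χ : Fin k → (↥(aSocle G ⊓ N) →* Fˣ), ∀ a : ↥(aSocle G ⊓ N),
        (∀ i (g : G), χ i (MulAut.conjNormal g a) = 1) → a = 1 := by
  have hcA : IsMulCommutative (aSocle G) :=
    ⟨⟨fun x y => Subtype.ext (aSocle_commute x.2 y.2)⟩⟩
  have hcB : IsMulCommutative ↥(aSocle G ⊓ N) :=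
    ⟨⟨fun x y => Subtype.ext (aSocle_commute x.2.1 y.2.1)⟩⟩
  have hA := aSocle_normal (G := G)
  have := hN
  exact group_duality _ k F hchar (semisimple_of_le (aSocle G) inf_le_left
    (semisimple_of_sSup (aSocle G) _ (fun M hM => hM.1) rfl))

theorem card_ne_zero_of_char (hchar : ¬ (ringChar F ∣ Nat.card ↥(aSocle G ⊓ N))) :
    (Nat.card ↥(aSocle G ⊓ N) : F) ≠ 0 := fun h =>
  hchar ((CharP.cast_eq_zero_iff F (ringChar F) _).1 h)


theorem simpleFaithful_of_gen (hN : N.Normal)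
    (hchar : ¬ (ringChar F ∣ Nat.card ↥(aSocle G ⊓ N))) {k : ℕ} (hk : 1 ≤ k)
    (h : NormallyKGenerated (socle G ⊓ N) k) : SimpleFaithful F N k := by
  have hA := aSocle_normal (G := G)
  have hn : (aSocle G ⊓ N).Normal := inferInstance
  obtain ⟨χ, hχ⟩ := (abelian_duality F hN hchar k hn).1 (gen_aSocle_of_gen_socle hN h)
  have hJ : ∀ i, ∃ J : Ideal (MonoidAlgebra F G), J.IsMaximal ∧ ∃ x, x ∉ J ∧
      (∀ a : ↥(aSocle G ⊓ N),
        MonoidAlgebra.of F G (a : G) * x = ((χ i a : Fˣ) : F) • x) ∧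
      ∀ M : Subgroup G, NonabMin M → ∃ g ∈ M, ∃ c : F, c ≠ 1 ∧
        MonoidAlgebra.of F G g * x = c • x := by
    intro i
    obtain ⟨Q, _, _, φ, ψ, ι, hinj, hc, hr, h1, h2, h3⟩ :=
      exists_char_data F (aSocle G ⊓ N) inf_le_left (card_ne_zero_of_char F hchar) (χ i)
        {M | NonabMin M} (Set.toFinite _) (fun K hK => hK)
    obtain ⟨J, hJ, x, hx, hw⟩ := exists_maximal_weight F φ hinj ψ hc
    refine ⟨J, hJ, x, hx, fun a => ?_, fun M hM => ?_⟩
    · rw [← h1, hw, h2]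
    · obtain ⟨q, hq, hq1⟩ := h3 M hM
      exact ⟨φ q, hq, _, fun h => hq1 (Units.ext h), hw q⟩
  choose J hJm x hx hxa hxM using hJ
  refine ⟨J, hJm, ?_⟩
  have hsc : ∀ i (c : F), c • x i - x i ∈ J i → c = 1 := by
    intro i c hc
    by_contra hne
    have hne' : c - 1 ≠ 0 := sub_ne_zero.2 hne
    apply hx i
    have h1 : c • x i - x i = (c - 1) • x i := by rw [sub_smul, one_smul]
    rw [h1] at hc
    have h2 := (J i).mul_mem_left (algebraMap F _ (c - 1)⁻¹) hc
    rwa [← Algebra.smul_def, smul_smul, inv_mul_cancel₀ hne', one_smul] at h2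
  let K : Subgroup G := jKer F J N hN
  have hK : K.Normal := jKer_normal F J N hN
  have hKbot : K = ⊥ := by
    by_contra hne
    obtain ⟨M, hMK, hM⟩ := exists_minNormal_le hK hne
    by_cases hMa : ∀ x ∈ M, ∀ y ∈ M, x * y = y * x
    · apply hM.2.1
      rw [eq_bot_iff]
      intro a ha
      have haA : a ∈ aSocle G ⊓ N := ⟨minNormal_le_aSocle hM hMa ha, (hMK ha).1⟩
      have h1 := hχ ⟨a, haA⟩ (fun i g => by
        refine Units.ext (hsc i _ ?_)
        rw [← hxa i]
        have hg : g * a * g⁻¹ ∈ K := hK.conj_mem a (hMK ha) g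
        exact hg.2 i (x i))
      exact congrArg Subtype.val h1
    · obtain ⟨g, hg, c, hc, hgc⟩ := hxM ⟨0, hk⟩ M ⟨hM, hMa⟩
      refine hc (hsc ⟨0, hk⟩ c ?_)
      rw [← hgc]
      exact (hMK hg).2 _ _
  intro g hg hg'
  have : g ∈ K := ⟨hg, hg'⟩
  rw [hKbot] at this
  exact this

theorem gen_of_simpleFaithful (hN : N.Normal)
    (hchar : ¬ (ringChar F ∣ Nat.card ↥(aSocle G ⊓ N))) {k : ℕ} (hk : 1 ≤ k)
    (h : SimpleFaithful F N k) : NormallyKGenerated (socle G ⊓ N) k := by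
  have hA := aSocle_normal (G := G)
  have hn : (aSocle G ⊓ N).Normal := inferInstance
  obtain ⟨J, hJm, hJ⟩ := h
  refine gen_socle_of_gen_aSocle hN hk ((abelian_duality F hN hchar k hn).2 ?_)
  have hw := fun i => exists_weight_quot F (aSocle G ⊓ N)
    (fun x hx y hy => aSocle_commute hx.1 hy.1) (J i) (hJm i)
  choose x χ hx hxχ using hw
  refine ⟨χ, fun a ha => Subtype.ext (hJ a a.2.2 fun i y => ?_)⟩
  refine conj_trivial_span F (J i) (hJm i) (x i) (hx i) a (fun g => ?_) y
  have h1 := hxχ i (MulAut.conjNormal g a)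
  rw [ha i g, Units.val_one, one_smul, MulAut.conjNormal_apply] at h1
  exact h1

end MainEquiv

section Modules

variable {G : Type} [Group G] [Finite G] {N : Subgroup G} (F : Type) [Field F]

theorem trivial_of_unipotent {M : Type} [AddCommGroup M] [Module (MonoidAlgebra F G) M] (g : G)
    (ho : ((orderOf g : ℕ) : F) ≠ 0) (k : ℕ)
    (h : ∀ v : M, (MonoidAlgebra.of F G g - 1) ^ k • v = 0) (v : M) :
    MonoidAlgebra.of F G g • v = v := by
  open Polynomial in
  let n := orderOf g
  let q : F[X] := ∑ i ∈ Finset.range n, X ^ i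
  have hq : q * (X - C 1) = X ^ n - 1 := by
    rw [C_1]; exact geom_sum_mul X n
  have hcop : IsCoprime (X - C 1 : F[X]) q := by
    rw [(irreducible_X_sub_C (1 : F)).coprime_iff_not_dvd, dvd_iff_isRoot]
    simpa [q, IsRoot, eval_finsetSum] using ho
  obtain ⟨a, b, hab⟩ := hcop.pow_left (m := k)
  let T := MonoidAlgebra.of F G g
  have hT : aeval T (X - C 1 : F[X]) = T - 1 := by simp
  have hz : aeval T q * (T - 1) = 0 := by
    rw [← hT, ← map_mul, hq]
    simp only [map_sub, map_pow, aeval_X, map_one, T, n]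
    rw [← map_pow, pow_orderOf_eq_one, map_one, sub_self]
  have h1 := congrArg (aeval T) hab
  rw [map_add, map_mul, map_mul, map_pow, hT, map_one] at h1
  have h2 : (T - 1) • v = 0 := by
    calc (T - 1) • v = (1 : MonoidAlgebra F G) • (T - 1) • v := by rw [one_smul]
      _ = 0 := by
        nth_rewrite 1 [← h1]
        rw [add_smul, mul_smul, h, smul_zero, zero_add, smul_smul, mul_assoc, hz, mul_zero,
          zero_smul]
  rwa [sub_smul, one_smul, sub_eq_zero] at h2

theorem trivial_iff_of_equiv {M : Type} [AddCommGroup M] [Module (MonoidAlgebra F G) M]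
    (J : Ideal (MonoidAlgebra F G)) (e : M ≃ₗ[MonoidAlgebra F G] MonoidAlgebra F G ⧸ J) (g : G) :
    (∀ x, MonoidAlgebra.of F G g * x - x ∈ J) ↔ ∀ v : M, MonoidAlgebra.of F G g • v = v := by
  constructor
  · intro h v
    apply e.injective
    rw [map_smul]
    obtain ⟨x, hx⟩ := Submodule.Quotient.mk_surjective J (e v)
    rw [← hx, ← Submodule.Quotient.mk_smul, Submodule.Quotient.eq]
    exact h x
  · intro h x
    have := congrArg e (h (e.symm (Submodule.Quotient.mk x)))
    rw [map_smul, e.apply_symm_apply, ← Submodule.Quotient.mk_smul, Submodule.Quotient.eq] at this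
    exact this

theorem asModule_trivial {V : Type} [AddCommGroup V] [Module F V] (ρ : Representation F G V) (g : G) :
    (∀ v : V, ρ g v = v) ↔ ∀ v : ρ.asModule, MonoidAlgebra.of F G g • v = v := by
  have key : ∀ v : ρ.asModule, ρ.asModuleEquiv (MonoidAlgebra.of F G g • v)
      = ρ g (ρ.asModuleEquiv v) := by
    intro v
    rw [Representation.asModuleEquiv_map_smul, Representation.asAlgebraHom_of]
  constructor
  · intro h v
    apply ρ.asModuleEquiv.injective
    rw [key, h]
  · intro h v
    have := key (ρ.asModuleEquiv.symm v)
    rw [h, LinearEquiv.apply_symm_apply] at this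
    exact this.symm

theorem simpleFaithful_of_series (hN : N.Normal)
    (hchar : ¬ (ringChar F ∣ Nat.card ↥(aSocle G ⊓ N))) {k : ℕ}
    {V : Type} [AddCommGroup V] [Module (MonoidAlgebra F G) V]
    (hf : ∀ g ∈ N, (∀ v : V, MonoidAlgebra.of F G g • v = v) → g = 1)
    (s : CompositionSeries (Submodule (MonoidAlgebra F G) V))
    (hs1 : s.head = ⊥) (hs2 : s.last = ⊤) (hs3 : s.length = k) : SimpleFaithful F N k := by
  subst hs3
  have hq : ∀ i : Fin s.length, ∃ J : Ideal (MonoidAlgebra F G), J.IsMaximal ∧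
      Nonempty ((s i.succ ⧸ (s i.castSucc).comap (s i.succ).subtype) ≃ₗ[MonoidAlgebra F G]
        (MonoidAlgebra F G ⧸ J)) := by
    intro i
    have hc : s i.castSucc ⋖ s i.succ := s.step i
    exact isSimpleModule_iff_quot_maximal.1 ((covBy_iff_quot_is_simple hc.le).1 hc)
  choose J hJm hJe using hq
  refine ⟨J, hJm, ?_⟩
  have hstep : ∀ g, (∀ i x, MonoidAlgebra.of F G g * x - x ∈ J i) → ∀ i : Fin s.length,
      ∀ v ∈ s i.succ, (MonoidAlgebra.of F G g - 1) • v ∈ s i.castSucc := by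
    intro g hg i v hv
    obtain ⟨e⟩ := hJe i
    have h1 := (trivial_iff_of_equiv F (J i) e g).1 (hg i) (Submodule.Quotient.mk ⟨v, hv⟩)
    rw [← Submodule.Quotient.mk_smul, Submodule.Quotient.eq] at h1
    rw [sub_smul, one_smul]
    exact h1
  have huni : ∀ g, (∀ i x, MonoidAlgebra.of F G g * x - x ∈ J i) → ∀ v : V,
      (MonoidAlgebra.of F G g - 1) ^ s.length • v = 0 := by
    intro g hg
    have : ∀ i : Fin (s.length + 1), ∀ v ∈ s i,
        (MonoidAlgebra.of F G g - 1) ^ (i : ℕ) • v = 0 := by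
      intro i
      induction i using Fin.induction with
      | zero =>
        intro v hv
        have : v ∈ s.head := hv
        rw [hs1, Submodule.mem_bot] at this
        rw [this, smul_zero]
      | succ i ih =>
        intro v hv
        rw [Fin.val_succ, pow_succ, mul_smul]
        exact ih _ (hstep g hg i v hv)
    intro v
    refine this (Fin.last _) v ?_
    have : v ∈ s.last := hs2 ▸ Submodule.mem_top
    exact this
  have htriv : ∀ g ∈ jKer F J N hN, ((orderOf g : ℕ) : F) ≠ 0 → g = 1 := by
    rintro g ⟨hg, hg'⟩ ho
    exact hf g hg (trivial_of_unipotent F g ho _ (huni g hg'))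
  have hKbot : jKer F J N hN = ⊥ := by
    by_contra hne
    obtain ⟨M, hMK, hM⟩ := exists_minNormal_le (jKer_normal F J N hN) hne
    by_cases hMa : ∀ x ∈ M, ∀ y ∈ M, x * y = y * x
    · apply hM.2.1
      rw [eq_bot_iff]
      intro a ha
      refine htriv a (hMK ha) fun h0 => hchar ?_
      have haA : a ∈ aSocle G ⊓ N := ⟨minNormal_le_aSocle hM hMa ha, (hMK ha).1⟩
      exact ((CharP.cast_eq_zero_iff F (ringChar F) _).1 h0).trans
        (Subgroup.orderOf_dvd_natCard _ haA)
    · obtain ⟨t, ht, ht1, hto⟩ := nonab_exists_elt F (M := M) ⟨hM, hMa⟩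
      exact ht1 (htriv t (hMK ht) hto)
  intro g hg hg'
  have : g ∈ jKer F J N hN := ⟨hg, hg'⟩
  rw [hKbot] at this
  exact this

theorem simpleFaithful_of_sum {k n : ℕ} (ρ : Representation F G (Fin n → F))
    (hf : ∀ g ∈ N, (∀ v : Fin n → F, ρ g v = v) → g = 1)
    (W : Fin k → Submodule (MonoidAlgebra F G) ρ.asModule)
    (hW : ∀ i, IsSimpleModule (MonoidAlgebra F G) ↥(W i))
    (hI : DirectSum.IsInternal W) : SimpleFaithful F N k := by
  choose J hJm hJe using fun i => isSimpleModule_iff_quot_maximal.1 (hW i)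
  refine ⟨J, hJm, fun g hg h => hf g hg ((asModule_trivial F ρ g).2 fun v => ?_)⟩
  have hv : v ∈ ⨆ i, W i := hI.submodule_iSup_eq_top ▸ Submodule.mem_top
  induction hv using Submodule.iSup_induction' with
  | mem i x hx =>
    obtain ⟨e⟩ := hJe i
    exact congrArg Subtype.val ((trivial_iff_of_equiv F (J i) e g).1 (h i) ⟨x, hx⟩)
  | zero => exact smul_zero _
  | add x y _ _ hx hy => rw [smul_add, hx, hy]

/-- Realise a finite `F[G]`-module on a coordinate space. -/
theorem exists_rep_equiv (M : Type) [AddCommGroup M] [Module F M] [Module (MonoidAlgebra F G) M]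
    [IsScalarTower F (MonoidAlgebra F G) M] [Module.Finite F M] :
    ∃ (n : ℕ) (ρ : Representation F G (Fin n → F)),
      Nonempty (ρ.asModule ≃ₗ[MonoidAlgebra F G] M) := by
  let b : M ≃ₗ[F] (Fin (Module.finrank F M) → F) := (Module.finBasis F M).equivFun
  let σ : Representation F G M := Representation.ofModule' M
  have hσ : ∀ g v, σ g v = MonoidAlgebra.of F G g • v := fun g v => by
    simp [σ, Representation.ofModule']
  let ρ : Representation F G (Fin (Module.finrank F M) → F) :=
    { toFun := fun g => b.toLinearMap ∘ₗ σ g ∘ₗ b.symm.toLinearMap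
      map_one' := by ext; simp
      map_mul' := fun x y => by ext; simp }
  have hρ : ∀ g v, ρ g v = b (σ g (b.symm v)) := fun _ _ => rfl
  have key : ∀ (r : MonoidAlgebra F G) (v : Fin (Module.finrank F M) → F),
      b.symm (ρ.asAlgebraHom r v) = r • b.symm v := by
    intro r
    induction r using MonoidAlgebra.induction_on with
    | of g =>
      intro v
      rw [Representation.asAlgebraHom_of, hρ, LinearEquiv.symm_apply_apply, hσ]
    | add r s hr hs =>
      intro v
      rw [map_add, LinearMap.add_apply, map_add, hr, hs, add_smul]
    | smul c r hr =>
      intro v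
      rw [map_smul, LinearMap.smul_apply, map_smul, hr, smul_assoc]
  refine ⟨_, ρ, ⟨{ (ρ.asModuleEquiv.trans b.symm).toAddEquiv with map_smul' := fun r v => ?_ }⟩⟩
  change b.symm (ρ.asModuleEquiv (r • v)) = r • b.symm (ρ.asModuleEquiv v)
  rw [Representation.asModuleEquiv_map_smul, key]

theorem exists_rep_of_simpleFaithful {k : ℕ} (h : SimpleFaithful F N k) :
    ∃ (n : ℕ) (ρ : Representation F G (Fin n → F)) (J : Fin k → Ideal (MonoidAlgebra F G)),
      (∀ g ∈ N, (∀ v : Fin n → F, ρ g v = v) → g = 1) ∧ (∀ i, (J i).IsMaximal) ∧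
      Nonempty (ρ.asModule ≃ₗ[MonoidAlgebra F G] (Π i, MonoidAlgebra F G ⧸ J i)) := by
  obtain ⟨J, hJm, hJ⟩ := h
  have : Module.Finite F (MonoidAlgebra F G) := inferInstance
  obtain ⟨n, ρ, ⟨e⟩⟩ := exists_rep_equiv (G := G) F (Π i, MonoidAlgebra F G ⧸ J i)
  refine ⟨n, ρ, J, fun g hg h => hJ g hg fun i x => ?_, hJm, ⟨e⟩⟩
  have h1 := (asModule_trivial F ρ g).1 h (e.symm (fun i => Submodule.Quotient.mk x))
  have h2 := congrArg e h1
  rw [map_smul, e.apply_symm_apply] at h2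
  have h3 := congrFun h2 i
  rw [Pi.smul_apply, ← Submodule.Quotient.mk_smul, Submodule.Quotient.eq] at h3
  exact h3

theorem series_of_simpleFaithful {k : ℕ} (h : SimpleFaithful F N k) :
    ∃ (n : ℕ) (ρ : Representation F G (Fin n → F)),
        (∀ g ∈ N, (∀ v : Fin n → F, ρ g v = v) → g = 1) ∧
        ∃ s : CompositionSeries (Submodule (MonoidAlgebra F G) ρ.asModule),
          s.head = ⊥ ∧ s.last = ⊤ ∧ s.length = k := by
  obtain ⟨n, ρ, J, hf, hJm, ⟨e⟩⟩ := exists_rep_of_simpleFaithful F h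
  have hs : ∀ i, IsSimpleModule (MonoidAlgebra F G) (MonoidAlgebra F G ⧸ J i) := fun i =>
    isSimpleModule_iff_quot_maximal.2 ⟨J i, hJm i, ⟨LinearEquiv.refl _ _⟩⟩
  have hlen : Module.length (MonoidAlgebra F G) ρ.asModule = k := by
    rw [e.length_eq, Module.length_pi_of_fintype]
    simp [Module.length_eq_one]
  have hfl : IsFiniteLength (MonoidAlgebra F G) ρ.asModule := by
    rw [← Module.length_ne_top_iff, hlen]
    exact ENat.natCast_ne_top k
  obtain ⟨s, h1, h2⟩ := isFiniteLength_iff_exists_compositionSeries.1 hfl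
  refine ⟨n, ρ, hf, s, h1, h2, ?_⟩
  have := Module.length_compositionSeries s h1 h2
  rw [hlen] at this
  exact_mod_cast this

theorem sum_of_simpleFaithful {k : ℕ} (h : SimpleFaithful F N k) :
    ∃ (n : ℕ) (ρ : Representation F G (Fin n → F)),
        (∀ g ∈ N, (∀ v : Fin n → F, ρ g v = v) → g = 1) ∧
        ∃ W : Fin k → Submodule (MonoidAlgebra F G) ρ.asModule,
          (∀ i, IsSimpleModule (MonoidAlgebra F G) ↥(W i)) ∧
          DirectSum.IsInternal W := by
  obtain ⟨n, ρ, J, hf, hJm, ⟨e⟩⟩ := exists_rep_of_simpleFaithful F h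
  have hs : ∀ i, IsSimpleModule (MonoidAlgebra F G) (MonoidAlgebra F G ⧸ J i) := fun i =>
    isSimpleModule_iff_quot_maximal.2 ⟨J i, hJm i, ⟨LinearEquiv.refl _ _⟩⟩
  let f : ∀ i, (MonoidAlgebra F G ⧸ J i) →ₗ[MonoidAlgebra F G] ρ.asModule := fun i =>
    e.symm.toLinearMap ∘ₗ LinearMap.single (MonoidAlgebra F G) (fun i => MonoidAlgebra F G ⧸ J i) i
  have hinj : ∀ i, Function.Injective (f i) := fun i =>
    by
    intro x y hxy
    exact Pi.single_injective (M := fun i => MonoidAlgebra F G ⧸ J i) i (e.symm.injective hxy)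
  have hef : ∀ i x, e (f i x) = Pi.single i x := fun i x => e.apply_symm_apply _
  refine ⟨n, ρ, hf, fun i => LinearMap.range (f i), fun i => ?_, ?_⟩
  · exact (isSimpleModule_iff_quot_maximal.2
      ⟨J i, hJm i, ⟨(LinearEquiv.ofInjective (f i) (hinj i)).symm⟩⟩)
  · apply DirectSum.isInternal_submodule_of_iSupIndep_of_iSup_eq_top
    · intro i
      rw [Submodule.disjoint_def]
      rintro _ ⟨x, rfl⟩ hx
      have hle : (⨆ j, ⨆ (_ : j ≠ i), LinearMap.range (f j)) ≤
          LinearMap.ker ((LinearMap.proj i) ∘ₗ e.toLinearMap) := by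
        refine iSup₂_le fun j hj => ?_
        rintro _ ⟨y, rfl⟩
        rw [LinearMap.mem_ker]
        change e (f j y) i = 0
        rw [hef, Pi.single_eq_of_ne hj.symm]
      have h1 : e (f i x) i = 0 := hle hx
      rw [hef, Pi.single_eq_same] at h1
      rw [h1, map_zero]
    · rw [eq_top_iff]
      intro v _
      have h1 : v = ∑ i, f i (e v i) := by
        apply e.injective
        rw [map_sum]
        simp only [hef]
        exact (Finset.univ_sum_single (e v)).symm
      rw [h1]
      exact Submodule.sum_mem _ fun i _ => Submodule.mem_iSup_of_mem i ⟨_, rfl⟩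

end Modules

/-- Let `G` be a finite group, `N ⊴ G`, `F` an algebraically closed field whose
characteristic does not divide `|A(G) ∩ N|`, and `k ≥ 1`.  The following are
equivalent: (1) `S(G) ∩ N` is `k`-generated as a normal subgroup of `G`;
(2) there is an `F[G]`-module that is a direct sum of `k` simple modules and whose
restriction to `N` is faithful; (3) there is a finite-dimensional `F[G]`-module of
length `k` whose restriction to `N` is faithful. -/
theorem relative_zmud_alg_closed (G : Type) [Group G] [Finite G] (N : Subgroup G)
    (hN : N.Normal) (F : Type) [Field F] [IsAlgClosed F]
    (hchar : ¬ (ringChar F ∣ Nat.card ↥(aSocle G ⊓ N))) (k : ℕ) (hk : 1 ≤ k) :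
    (NormallyKGenerated (socle G ⊓ N) k ↔
      (∃ (n : ℕ) (ρ : Representation F G (Fin n → F)),
        (∀ g ∈ N, (∀ v : Fin n → F, ρ g v = v) → g = 1) ∧
        ∃ W : Fin k → Submodule (MonoidAlgebra F G) ρ.asModule,
          (∀ i, IsSimpleModule (MonoidAlgebra F G) ↥(W i)) ∧
          DirectSum.IsInternal W)) ∧
    ((∃ (n : ℕ) (ρ : Representation F G (Fin n → F)),
        (∀ g ∈ N, (∀ v : Fin n → F, ρ g v = v) → g = 1) ∧
        ∃ W : Fin k → Submodule (MonoidAlgebra F G) ρ.asModule,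
          (∀ i, IsSimpleModule (MonoidAlgebra F G) ↥(W i)) ∧
          DirectSum.IsInternal W) ↔
      (∃ (n : ℕ) (ρ : Representation F G (Fin n → F)),
        (∀ g ∈ N, (∀ v : Fin n → F, ρ g v = v) → g = 1) ∧
        ∃ s : CompositionSeries (Submodule (MonoidAlgebra F G) ρ.asModule),
          s.head = ⊥ ∧ s.last = ⊤ ∧ s.length = k)) := by
  have h1 := fun h => simpleFaithful_of_gen F hN hchar hk h
  have h2 := fun h => gen_of_simpleFaithful F hN hchar hk h
  refine ⟨⟨fun h => sum_of_simpleFaithful F (h1 h), ?_⟩, ⟨?_, ?_⟩⟩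
  · rintro ⟨n, ρ, hf, W, hW, hI⟩
    exact h2 (simpleFaithful_of_sum F ρ hf W hW hI)
  · rintro ⟨n, ρ, hf, W, hW, hI⟩
    exact series_of_simpleFaithful F (simpleFaithful_of_sum F ρ hf W hW hI)
  · rintro ⟨n, ρ, hf, s, hs1, hs2, hs3⟩
    exact sum_of_simpleFaithful F (simpleFaithful_of_series F hN hchar (V := ρ.asModule)
      (fun g hg h => hf g hg ((asModule_trivial F ρ g).2 h)) s hs1 hs2 hs3)
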